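/- arXiv:1603.01357 — 2 statements merged into one kernel-verified Lean document; each statement's English description precedes it below -/
import Mathlib

section
/- Let T be a polytope in ℝ^m with non-empty interior, and let L ⊆ ℝ^m be an affine subspace of dimension m − d. For k = 0,…,m let a_k denote the number of k-dimensional faces of T that have non-empty intersection with L. Then Σ_{k=0}^{m} (−1)^k a_k equals (−1)^d if L meets the interior of T, and equals 0 if L does not meet the interior of T. -/
open scoped Classical
open Pointwise

/-- The dimension of a set: the dimension of its affine hull. -/
noncomputable def adim {m : ℕ} (s : Set (EuclideanSpace ℝ (Fin m))) : ℕ :=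
  Module.finrank ℝ (affineSpan ℝ s).direction

/-- `F` is a face of the polytope `P`: either `F = P` (the improper face), or `F` is the
nonempty intersection of `P` with a hyperplane bounding a closed half-space containing `P`. -/
def IsFace {m : ℕ} (P F : Set (EuclideanSpace ℝ (Fin m))) : Prop :=
  F = P ∨ (F.Nonempty ∧ ∃ (f : EuclideanSpace ℝ (Fin m) →ₗ[ℝ] ℝ) (c : ℝ),
    f ≠ 0 ∧ (∀ x ∈ P, f x ≤ c) ∧ F = {x ∈ P | f x = c})

open Set Filter Topology

/-- The integer-valued indicator function of a set. -/
noncomputable def ind {α : Type*} (s : Set α) (x : α) : ℤ := if x ∈ s then 1 else 0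

@[simp]
theorem ind_of_mem {α : Type*} {s : Set α} {x : α} (h : x ∈ s) : ind s x = 1 := if_pos h

@[simp]
theorem ind_of_notMem {α : Type*} {s : Set α} {x : α} (h : x ∉ s) : ind s x = 0 := if_neg h

theorem ind_congr {α β : Type*} {s : Set α} {t : Set β} {x : α} {y : β} (h : x ∈ s ↔ y ∈ t) :
    ind s x = ind t y := by
  by_cases hx : x ∈ s
  · rw [ind_of_mem hx, ind_of_mem (h.1 hx)]
  · rw [ind_of_notMem hx, ind_of_notMem (h.not.1 hx)]

/-! ### Euler characteristic of step functions on the line -/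

/-- `f : ℝ → ℤ` differs from its right limit only at finitely many points, and the jumps
`f t - f (t+)` add up to `n`. For constructible functions with compact support, `n` is the
integral of `f` with respect to the Euler characteristic. -/
def HasEulerIntegral (f : ℝ → ℤ) (n : ℤ) : Prop :=
  ∃ j : ℝ →₀ ℤ, (∀ t, ∀ᶠ s in 𝓝[>] t, f t - f s = j t) ∧ (j.sum fun _ a => a) = n

namespace HasEulerIntegral

theorem unique {f : ℝ → ℤ} {n n' : ℤ} (h : HasEulerIntegral f n) (h' : HasEulerIntegral f n') :
    n = n' := by
  obtain ⟨j, hj, rfl⟩ := h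
  obtain ⟨j', hj', rfl⟩ := h'
  have : j = j' := by
    ext t
    obtain ⟨s, hs, hs'⟩ := ((hj t).and (hj' t)).exists
    exact hs.symm.trans hs'
  rw [this]

theorem zero : HasEulerIntegral (fun _ => 0) 0 := ⟨0, by simp, by simp⟩

theorem add {f g : ℝ → ℤ} {a b : ℤ} (hf : HasEulerIntegral f a) (hg : HasEulerIntegral g b) :
    HasEulerIntegral (fun t => f t + g t) (a + b) := by
  obtain ⟨j, hj, rfl⟩ := hf
  obtain ⟨k, hk, rfl⟩ := hg
  refine ⟨j + k, fun t => ?_, Finsupp.sum_add_index' (by simp) (by simp)⟩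
  filter_upwards [hj t, hk t] with s h1 h2
  simp only [Finsupp.add_apply, ← h1, ← h2]
  ring

theorem const_mul {f : ℝ → ℤ} {a : ℤ} (c : ℤ) (hf : HasEulerIntegral f a) :
    HasEulerIntegral (fun t => c * f t) (c * a) := by
  obtain ⟨j, hj, rfl⟩ := hf
  refine ⟨c • j, fun t => ?_, ?_⟩
  · filter_upwards [hj t] with s h1
    simp only [Finsupp.smul_apply, ← h1, smul_eq_mul]
    ring
  · rw [Finsupp.sum_smul_index (by simp), Finsupp.mul_sum]

theorem sum {ι : Type*} (I : Finset ι) {f : ι → ℝ → ℤ} {a : ι → ℤ}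
    (h : ∀ i ∈ I, HasEulerIntegral (f i) (a i)) :
    HasEulerIntegral (fun t => ∑ i ∈ I, f i t) (∑ i ∈ I, a i) := by
  induction I using Finset.induction_on with
  | empty => simpa using zero
  | insert i I hi ih =>
    simp only [Finset.sum_insert hi]
    exact (h i (by simp)).add (ih fun k hk => h k (by simp [hk]))

theorem of_jump {f : ℝ → ℤ} (b : ℝ) (n : ℤ) (hb : ∀ᶠ s in 𝓝[>] b, f b - f s = n)
    (h : ∀ t ≠ b, ∀ᶠ s in 𝓝[>] t, f t = f s) : HasEulerIntegral f n := by
  refine ⟨Finsupp.single b n, fun t => ?_, by simp⟩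
  obtain rfl | ht := eq_or_ne t b
  · simpa using hb
  · filter_upwards [h t ht] with s hs
    simp [hs, ht.symm]

theorem Icc {a b : ℝ} (hab : a ≤ b) :
    HasEulerIntegral (ind (Set.Icc a b)) 1 := by
  refine of_jump b 1 ?_ fun t ht => ?_
  · filter_upwards [self_mem_nhdsWithin] with s hs
    simp [ind, hab, not_le.2 (mem_Ioi.1 hs)]
  · rcases lt_or_gt_of_ne ht with h | h
    · rcases lt_or_ge t a with h' | h'
      · filter_upwards [Ioo_mem_nhdsGT h'] with s hs
        simp [ind, not_le.2 h', not_le.2 hs.2]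
      · filter_upwards [Ioo_mem_nhdsGT h] with s hs
        simp [ind, h', h.le, hs.2.le, h'.trans hs.1.le]
    · filter_upwards [self_mem_nhdsWithin] with s hs
      simp [ind, not_le.2 h, not_le.2 (h.trans hs)]

theorem Ioo {a b : ℝ} (hab : a < b) :
    HasEulerIntegral (ind (Set.Ioo a b)) (-1) := by
  refine of_jump a (-1) ?_ fun t ht => ?_
  · filter_upwards [Ioo_mem_nhdsGT hab] with s hs
    simp [ind, hs.1, hs.2]
  · rcases lt_or_gt_of_ne ht with h | h
    · filter_upwards [Ioo_mem_nhdsGT h] with s hs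
      simp [ind, not_lt.2 h.le, not_lt.2 hs.2.le]
    · rcases lt_or_ge t b with h' | h'
      · filter_upwards [Ioo_mem_nhdsGT h'] with s hs
        simp [ind, h, h', hs.2, h.trans hs.1]
      · filter_upwards [self_mem_nhdsWithin] with s hs
        simp [ind, not_lt.2 h', not_lt.2 (h'.trans (le_of_lt hs))]

theorem Ico (a b : ℝ) :
    HasEulerIntegral (ind (Set.Ico a b)) 0 := by
  refine ⟨0, fun t => ?_, by simp⟩
  simp only [Finsupp.coe_zero, Pi.zero_apply, sub_eq_zero]
  rcases lt_or_ge t a with h | h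
  · filter_upwards [Ioo_mem_nhdsGT h] with s hs
    simp [ind, not_le.2 h, not_le.2 hs.2]
  · rcases lt_or_ge t b with h' | h'
    · filter_upwards [Ioo_mem_nhdsGT h'] with s hs
      simp [ind, h, h', hs.2, h.trans hs.1.le]
    · filter_upwards [self_mem_nhdsWithin] with s hs
      simp [ind, not_lt.2 h', not_lt.2 (h'.trans (le_of_lt hs))]

theorem of_isCompact {s : Set ℝ} (hc : Convex ℝ s) (hs : IsCompact s) (hne : s.Nonempty) :
    HasEulerIntegral (ind s) 1 := by
  have h := eq_Icc_of_connected_compact ⟨hne, hc.isPreconnected⟩ hs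
  have hle : sInf s ≤ sSup s := by
    rw [← nonempty_Icc, ← h]
    exact hne
  rw [h]
  exact Icc hle

theorem of_isOpen {s : Set ℝ} (hc : Convex ℝ s) (hs : IsOpen s) (hne : s.Nonempty)
    (hb : BddBelow s) (ha : BddAbove s) :
    HasEulerIntegral (ind s) (-1) := by
  have h : s = Set.Ioo (sInf s) (sSup s) := by
    refine Subset.antisymm ?_
      (IsConnected.Ioo_csInf_csSup_subset ⟨hne, hc.isPreconnected⟩ hb ha)
    rw [← interior_Icc]
    exact hs.subset_interior_iff.2 (subset_Icc_csInf_csSup hb ha)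
  have hlt : sInf s < sSup s := by
    rw [← nonempty_Ioo, ← h]
    exact hne
  rw [h]
  exact Ioo hlt

end HasEulerIntegral

/-! ### Relatively open bounded convex sets -/

/-- A nonempty bounded convex set that is open in its affine span, described algebraically: every
segment inside the set can be prolonged inside the set beyond each of its endpoints. -/
structure IsRelOpenConvex {V : Type*} [AddCommGroup V] [Module ℝ V] (S : Set V) : Prop where
  nonempty : S.Nonempty
  convex : Convex ℝ S
  prolong : ∀ x ∈ S, ∀ y ∈ S, ∀ᶠ s in 𝓝[>] (0 : ℝ), x + s • (x - y) ∈ S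
  bounded : ∀ φ : V →ₗ[ℝ] ℝ, ∃ C, ∀ x ∈ S, |φ x| ≤ C

theorem convex_setOf_add_smul_mem {V : Type*} [AddCommGroup V] [Module ℝ V] {S : Set V}
    (hS : Convex ℝ S) (x v : V) : Convex ℝ {s : ℝ | x + s • v ∈ S} := by
  intro a ha b hb p q hp hq hpq
  have := hS ha hb hp hq hpq
  rw [Set.mem_ofPred_eq]
  convert this using 1
  linear_combination (norm := module) -(hpq • x)

namespace IsRelOpenConvex

variable {V W : Type*} [AddCommGroup V] [Module ℝ V] [AddCommGroup W] [Module ℝ W] {S : Set V}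

theorem image (hS : IsRelOpenConvex S) (p : V →ₗ[ℝ] W) : IsRelOpenConvex (p '' S) where
  nonempty := hS.nonempty.image p
  convex := hS.convex.linear_image p
  prolong := by
    rintro _ ⟨x, hx, rfl⟩ _ ⟨y, hy, rfl⟩
    filter_upwards [hS.prolong x hx y hy] with s hs
    exact ⟨_, hs, by simp⟩
  bounded φ := by
    obtain ⟨C, hC⟩ := hS.bounded (φ ∘ₗ p)
    exact ⟨C, by rintro _ ⟨x, hx, rfl⟩; exact hC x hx⟩

theorem exists_pos_add_smul_mem (hS : IsRelOpenConvex S) {x w : V} (hx : x ∈ S)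
    (hw : w ∈ vectorSpan ℝ S) : ∃ ε : ℝ, 0 < ε ∧ x + ε • w ∈ S ∧ x - ε • w ∈ S := by
  rw [vectorSpan_eq_span_vsub_set_right ℝ hx] at hw
  induction hw using Submodule.span_induction with
  | mem w hw =>
    obtain ⟨y, hy, rfl⟩ := hw
    obtain ⟨s, hs, hs0, hs1⟩ :=
      ((hS.prolong x hx y hy).and (Ioo_mem_nhdsGT (zero_lt_one' ℝ))).exists
    refine ⟨s, hs0, ?_, ?_⟩
    · convert hS.convex hx hy (sub_nonneg.2 hs1.le) hs0.le (by ring) using 1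
      simp only [vsub_eq_sub]
      module
    · convert hs using 1
      simp only [vsub_eq_sub]
      module
  | zero => exact ⟨1, one_pos, by simpa using hx, by simpa using hx⟩
  | add a b _ _ iha ihb =>
    obtain ⟨ε, hε, h1, h2⟩ := iha
    obtain ⟨δ, hδ, h3, h4⟩ := ihb
    have hne : ε + δ ≠ 0 := by positivity
    have hsum : δ / (ε + δ) + ε / (ε + δ) = 1 := by field_simp; ring
    refine ⟨ε * δ / (ε + δ), by positivity, ?_, ?_⟩
    · convert hS.convex h1 h3 (a := δ / (ε + δ)) (b := ε / (ε + δ)) (by positivity)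
        (by positivity) hsum using 1
      linear_combination (norm := module) -(hsum • x)
    · convert hS.convex h2 h4 (a := δ / (ε + δ)) (b := ε / (ε + δ)) (by positivity)
        (by positivity) hsum using 1
      linear_combination (norm := module) -(hsum • x)
  | smul r a _ ih =>
    obtain ⟨ε, hε, h1, h2⟩ := ih
    rcases lt_trichotomy r 0 with hr | rfl | hr
    · have e : (ε / -r) • r • a = -(ε • a) := by
        rw [smul_smul, ← neg_smul, div_mul_eq_mul_div, div_neg, mul_div_cancel_right₀ _ hr.ne]
      exact ⟨ε / -r, div_pos hε (neg_pos.2 hr), by rwa [e, ← sub_eq_add_neg],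
        by rwa [e, sub_neg_eq_add]⟩
    · exact ⟨1, one_pos, by simpa using hx, by simpa using hx⟩
    · have e : (ε / r) • r • a = ε • a := by
        rw [smul_smul]
        congr 1
        field_simp
      exact ⟨ε / r, div_pos hε hr, by rwa [e], by rwa [e]⟩

theorem isOpen_setOf_add_smul_mem (hS : IsRelOpenConvex S) (x : V) {v : V}
    (hv : v ∈ vectorSpan ℝ S) : IsOpen {s : ℝ | x + s • v ∈ S} := by
  rw [isOpen_iff_mem_nhds]
  intro s hs
  obtain ⟨ε, hε, h1, h2⟩ := hS.exists_pos_add_smul_mem hs hv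
  have key := (convex_setOf_add_smul_mem hS.convex x v).ordConnected.out
    (x := s - ε) (y := s + ε) (by rw [Set.mem_ofPred_eq]; convert h2 using 1; module)
    (by rw [Set.mem_ofPred_eq]; convert h1 using 1; module)
  exact mem_of_superset (Icc_mem_nhds (by linarith) (by linarith)) key

/-- The Euler integral of a relatively open convex set along a line of direction `v`. -/
theorem hasEulerIntegral_line (hS : IsRelOpenConvex S) {v : V} (hv : v ≠ 0) (x : V) :
    HasEulerIntegral (fun s : ℝ => ind S (x + s • v))
      ((if v ∈ vectorSpan ℝ S then -1 else 1) *
        ind ((ℝ ∙ v).mkQ '' S) ((ℝ ∙ v).mkQ x)) := by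
  by_cases hne : ∃ s : ℝ, x + s • v ∈ S
  swap
  · have h0 : (ℝ ∙ v).mkQ x ∉ (ℝ ∙ v).mkQ '' S := by
      rintro ⟨y, hy, hxy⟩
      obtain ⟨s, hs⟩ := Submodule.mem_span_singleton.1 ((Submodule.Quotient.eq _).1 hxy)
      exact hne ⟨s, by rwa [hs, add_sub_cancel]⟩
    rw [ind_of_notMem h0, mul_zero]
    push Not at hne
    simpa [hne] using HasEulerIntegral.zero
  have h1 : (ℝ ∙ v).mkQ x ∈ (ℝ ∙ v).mkQ '' S := by
    obtain ⟨s, hs⟩ := hne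
    refine ⟨_, hs, ?_⟩
    rw [map_add, add_eq_left, Submodule.mkQ_apply, Submodule.Quotient.mk_eq_zero]
    exact Submodule.mem_span_singleton.2 ⟨s, rfl⟩
  rw [ind_of_mem h1, mul_one]
  split_ifs with hvS
  · obtain ⟨φ, hφ⟩ := Module.Projective.exists_dual_eq_one ℝ hv
    obtain ⟨C, hC⟩ := hS.bounded φ
    have hb : ∀ s ∈ {s : ℝ | x + s • v ∈ S}, |φ x + s| ≤ C := fun s hs => by
      simpa [hφ] using hC _ hs
    exact HasEulerIntegral.of_isOpen (convex_setOf_add_smul_mem hS.convex x v)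
      (hS.isOpen_setOf_add_smul_mem x hvS) hne
      ⟨-C - φ x, fun s hs => by linarith [(abs_le.1 (hb s hs)).1]⟩
      ⟨C - φ x, fun s hs => by linarith [(abs_le.1 (hb s hs)).2]⟩
  · obtain ⟨s, hs⟩ := hne
    have : {s : ℝ | x + s • v ∈ S} = Set.Icc s s := by
      rw [Icc_self]
      refine eq_singleton_iff_unique_mem.2 ⟨hs, fun t ht => ?_⟩
      by_contra hts
      apply hvS
      have := (vectorSpan ℝ S).smul_mem (t - s)⁻¹ (vsub_mem_vectorSpan ℝ ht hs)
      rw [vsub_eq_sub, add_sub_add_left_eq_sub, ← sub_smul, smul_smul,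
        inv_mul_cancel₀ (sub_ne_zero.2 hts), one_smul] at this
      exact this
    have h := HasEulerIntegral.Icc (le_refl s)
    rw [← this] at h
    exact h

end IsRelOpenConvex

theorem finrank_vectorSpan_image_mkQ {V : Type*} [AddCommGroup V] [Module ℝ V]
    [FiniteDimensional ℝ V] (S : Set V) {v : V} (hv : v ≠ 0) :
    Module.finrank ℝ (vectorSpan ℝ S) =
      Module.finrank ℝ (vectorSpan ℝ ((ℝ ∙ v).mkQ '' S)) +
        if v ∈ vectorSpan ℝ S then 1 else 0 := by
  have hmap : vectorSpan ℝ ((ℝ ∙ v).mkQ '' S) = (vectorSpan ℝ S).map (ℝ ∙ v).mkQ :=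
    (AffineMap.map_vectorSpan (ℝ ∙ v).mkQ.toAffineMap).symm
  have h := ((ℝ ∙ v).mkQ.domRestrict (vectorSpan ℝ S)).finrank_range_add_finrank_ker
  rw [LinearMap.range_domRestrict, ← hmap] at h
  rw [← h]
  congr 1
  have hker : LinearMap.ker ((ℝ ∙ v).mkQ.domRestrict (vectorSpan ℝ S)) =
      (ℝ ∙ v).comap (vectorSpan ℝ S).subtype := by
    rw [LinearMap.domRestrict, LinearMap.ker_comp, Submodule.ker_mkQ]
  rw [hker, ← Submodule.finrank_map_subtype_eq, Submodule.map_comap_subtype]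
  split_ifs with hvS
  · rw [inf_eq_right.2 ((Submodule.span_singleton_le_iff_mem _ _).2 hvS), finrank_span_singleton hv]
  · rw [disjoint_iff.1 ((Submodule.disjoint_span_singleton' hv).2 hvS), finrank_bot]

section EulerCharacteristic

variable {ι : Type*} (I : Finset ι) (c : ι → ℤ)

theorem sum_mul_ind_image_mkQ_eq_zero {V : Type*} [AddCommGroup V] [Module ℝ V] {S : ι → Set V}
    (hS : ∀ i ∈ I, IsRelOpenConvex (S i)) {v : V} (hv : v ≠ 0)
    (h : ∀ x, HasEulerIntegral (fun s : ℝ => ∑ i ∈ I, c i * ind (S i) (x + s • v)) 0)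
    (y : V ⧸ (ℝ ∙ v)) :
    ∑ i ∈ I, (c i * if v ∈ vectorSpan ℝ (S i) then -1 else 1) * ind ((ℝ ∙ v).mkQ '' S i) y
      = 0 := by
  obtain ⟨x, rfl⟩ := (ℝ ∙ v).mkQ_surjective y
  refine (HasEulerIntegral.sum I fun i hi => ?_).unique (h x)
  rw [mul_assoc]
  exact ((hS i hi).hasEulerIntegral_line hv x).const_mul (c i)

theorem sum_mul_neg_one_pow_finrank_eq_sum_image_mkQ {V : Type*} [AddCommGroup V] [Module ℝ V]
    [FiniteDimensional ℝ V] (S : ι → Set V) {v : V} (hv : v ≠ 0) :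
    ∑ i ∈ I, c i * (-1) ^ Module.finrank ℝ (vectorSpan ℝ (S i)) =
      ∑ i ∈ I, (c i * if v ∈ vectorSpan ℝ (S i) then -1 else 1) *
        (-1) ^ Module.finrank ℝ (vectorSpan ℝ ((ℝ ∙ v).mkQ '' S i)) := by
  refine Finset.sum_congr rfl fun i _ => ?_
  rw [finrank_vectorSpan_image_mkQ (S i) hv]
  split_ifs <;> ring

/-- The Euler characteristic with compact support is well defined on integer combinations of
indicators of relatively open bounded convex sets. -/
theorem sum_mul_neg_one_pow_finrank_eq_zero {V : Type*} [AddCommGroup V] [Module ℝ V]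
    [FiniteDimensional ℝ V] {S : ι → Set V} (hS : ∀ i ∈ I, IsRelOpenConvex (S i))
    (h : ∀ x, ∑ i ∈ I, c i * ind (S i) x = 0) :
    ∑ i ∈ I, c i * (-1) ^ Module.finrank ℝ (vectorSpan ℝ (S i)) = 0 := by
  induction hn : Module.finrank ℝ V generalizing V c with
  | zero =>
    have := Module.finrank_zero_iff.1 hn
    rw [← h 0]
    refine Finset.sum_congr rfl fun i hi => ?_
    obtain ⟨x, hx⟩ := (hS i hi).nonempty
    rw [Subsingleton.elim 0 x, ind_of_mem hx, Module.finrank_zero_of_subsingleton, pow_zero]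
  | succ n ih =>
    have := Module.nontrivial_of_finrank_pos (R := ℝ) (M := V) (by omega)
    obtain ⟨v, hv⟩ := exists_ne (0 : V)
    rw [sum_mul_neg_one_pow_finrank_eq_sum_image_mkQ I c S hv]
    refine ih _ (fun i hi => (hS i hi).image _) (sum_mul_ind_image_mkQ_eq_zero I c hS hv ?_) ?_
    · simpa [h] using HasEulerIntegral.zero
    · have := (ℝ ∙ v).finrank_quotient_add_finrank
      rw [finrank_span_singleton hv] at this
      omega

/-- Fubini version of `sum_mul_neg_one_pow_finrank_eq_zero`: it is enough that the Euler
integrals along all lines parallel to a given one vanish. -/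
theorem sum_mul_neg_one_pow_finrank_eq_zero_of_lines {V : Type*} [AddCommGroup V] [Module ℝ V]
    [FiniteDimensional ℝ V] {S : ι → Set V} (hS : ∀ i ∈ I, IsRelOpenConvex (S i)) {v : V}
    (hv : v ≠ 0)
    (h : ∀ x, HasEulerIntegral (fun s : ℝ => ∑ i ∈ I, c i * ind (S i) (x + s • v)) 0) :
    ∑ i ∈ I, c i * (-1) ^ Module.finrank ℝ (vectorSpan ℝ (S i)) = 0 := by
  rw [sum_mul_neg_one_pow_finrank_eq_sum_image_mkQ I c S hv]
  exact sum_mul_neg_one_pow_finrank_eq_zero I _ (fun i hi => (hS i hi).image _)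
    (sum_mul_ind_image_mkQ_eq_zero I c hS hv h)

end EulerCharacteristic

/-! ### Faces of polytopes -/

/-- Either every segment in `C` ending at `x` can be prolonged in `C` beyond `x`, or `x` lies on a
supporting hyperplane that does not contain `C`. -/
theorem exists_prolong_or_exists_supporting {E : Type*} [NormedAddCommGroup E] [NormedSpace ℝ E]
    [FiniteDimensional ℝ E] {C : Set E} (hC : Convex ℝ C) {x : E} (hx : x ∈ C) :
    (∀ y ∈ C, ∃ s : ℝ, 0 < s ∧ x + s • (x - y) ∈ C) ∨
      ∃ f : E →L[ℝ] ℝ, (∀ y ∈ C, f y ≤ f x) ∧ ∃ y ∈ C, f y < f x := by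
  set W := vectorSpan ℝ C
  let D : Set W := {w | x + w ∈ C}
  have hmem : ∀ {y} (hy : y ∈ C), (⟨y - x, vsub_mem_vectorSpan ℝ hy hx⟩ : W) ∈ D := fun hy => by
    change x + (_ - x) ∈ C
    rwa [add_sub_cancel]
  have hD0 : (0 : W) ∈ D := by simpa [D] using hx
  have hD : Convex ℝ D := (hC.translate_preimage_right x).linear_preimage W.subtype
  have hint : (interior D).Nonempty := by
    rw [hD.interior_nonempty_iff_affineSpan_eq_top,
      AffineSubspace.affineSpan_eq_top_iff_vectorSpan_eq_top_of_nonempty ℝ W W ⟨0, hD0⟩,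
      vectorSpan_eq_span_vsub_set_right ℝ hD0]
    apply Submodule.map_injective_of_injective W.injective_subtype
    rw [Submodule.map_span, Submodule.map_subtype_top]
    change _ = vectorSpan ℝ C
    rw [vectorSpan_eq_span_vsub_set_right ℝ hx]
    congr 1
    ext w
    constructor
    · rintro ⟨_, ⟨w, hw, rfl⟩, rfl⟩
      exact ⟨_, hw, by simp⟩
    · rintro ⟨y, hy, rfl⟩
      exact ⟨_, ⟨_, hmem hy, rfl⟩, by simp⟩
  by_cases h0 : (0 : W) ∈ interior D
  · left
    intro y hy
    have hlim : Tendsto (fun s : ℝ => s • -(⟨y - x, vsub_mem_vectorSpan ℝ hy hx⟩ : W)) (𝓝[>] 0)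
        (𝓝 0) := by
      have hcont : Continuous fun s : ℝ =>
          s • -(⟨y - x, vsub_mem_vectorSpan ℝ hy hx⟩ : W) := by fun_prop
      exact (hcont.tendsto' 0 0 (zero_smul _ _)).mono_left nhdsWithin_le_nhds
    obtain ⟨s, hs, hs0⟩ :=
      ((hlim.eventually (mem_interior_iff_mem_nhds.1 h0)).and self_mem_nhdsWithin).exists
    refine ⟨s, hs0, ?_⟩
    change x + s • -(y - x) ∈ C at hs
    rwa [neg_sub] at hs
  · right
    obtain ⟨f, hf⟩ := geometric_hahn_banach_open_point hD.interior isOpen_interior h0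
    have hle : ∀ w ∈ D, f w ≤ 0 := fun w hw => by
      have : w ∈ closure (interior D) := by
        rw [hD.closure_interior_eq_closure_of_nonempty_interior hint]
        exact subset_closure hw
      refine closure_minimal (fun a ha => ?_) (isClosed_le f.continuous continuous_const) this
      simpa using (hf a ha).le
    obtain ⟨g, hg⟩ := (f : W →ₗ[ℝ] ℝ).exists_extend
    have hgf : ∀ w : W, g w = f w := fun w => LinearMap.congr_fun hg w
    refine ⟨LinearMap.toContinuousLinearMap g, fun y hy => ?_, ?_⟩
    · have := hle _ (hmem hy)
      rw [← hgf, map_sub] at this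
      simpa using this
    · obtain ⟨w, hw⟩ := hint
      refine ⟨x + w, interior_subset (s := D) hw, ?_⟩
      simpa [hgf] using hf w hw

section Faces

variable {m : ℕ} {T F G : Set (EuclideanSpace ℝ (Fin m))} {x y : EuclideanSpace ℝ (Fin m)}

theorem isFace_iff_isExposed (hT : T.Nonempty) :
    IsFace T F ↔ F.Nonempty ∧ IsExposed ℝ T F := by
  constructor
  · rintro (rfl | ⟨hF, f, c, -, hfc, rfl⟩)
    · exact ⟨hT, IsExposed.refl _⟩
    · refine ⟨hF, fun ⟨y, hy, hyc⟩ => ⟨LinearMap.toContinuousLinearMap f, ?_⟩⟩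
      ext x
      refine and_congr_right fun hx => ⟨fun hxc z hz => ?_, fun h => ?_⟩
      · simpa [hxc] using hfc z hz
      · exact le_antisymm (hfc x hx) (hyc ▸ h y hy)
  · rintro ⟨⟨x, hx⟩, hE⟩
    obtain ⟨l, hl⟩ := hE ⟨x, hx⟩
    rw [IsFace, or_iff_not_imp_left]
    have hx' := hx
    rw [hl] at hx'
    refine fun hne => ⟨⟨x, hx⟩, l, l x, ?_, fun y hy => hx'.2 y hy, ?_⟩
    · intro h0
      have h0' : ∀ y, l y = 0 := fun y => LinearMap.congr_fun h0 y
      exact hne (by simpa [h0'] using hl)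
    · rw [hl]
      ext y
      refine and_congr_right fun hy => ⟨fun h => ?_, fun h z hz => ?_⟩
      · exact le_antisymm (hx'.2 y hy) (h x hx'.1)
      · exact (hx'.2 z hz).trans_eq h.symm

theorem IsFace.isExposed (hF : IsFace T F) : IsExposed ℝ T F := by
  rcases T.eq_empty_or_nonempty with rfl | hT
  · rcases hF with rfl | ⟨hF, f, c, -, -, rfl⟩
    · exact IsExposed.refl _
    · simp at hF
  · exact ((isFace_iff_isExposed hT).1 hF).2

theorem IsFace.subset (hF : IsFace T F) : F ⊆ T := hF.isExposed.subset

theorem IsFace.mem_of_add_smul_mem (hF : IsFace T F) (hx : x ∈ T) (hy : y ∈ T) {r : ℝ}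
    (hr : r ∈ Ioo 0 1) (h : x + r • (y - x) ∈ F) : x ∈ F := by
  refine hF.isExposed.isExtreme.left_mem_of_mem_openSegment hx hy h ?_
  rw [openSegment_eq_image']
  exact ⟨r, hr, rfl⟩

theorem IsFace.eq_of_mem_interior (hF : IsFace T F) (hx : x ∈ interior T) (hxF : x ∈ F) :
    F = T := by
  refine hF.subset.antisymm fun y hy => ?_
  have hlim : Tendsto (fun s : ℝ => x + s • (x - y)) (𝓝[>] 0) (𝓝 x) :=
    (Continuous.tendsto' (by fun_prop) _ _ (by simp)).mono_left nhdsWithin_le_nhds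
  obtain ⟨s, hs, hs0 : 0 < s⟩ :=
    ((hlim.eventually (mem_interior_iff_mem_nhds.1 hx)).and self_mem_nhdsWithin).exists
  have h1 : (0 : ℝ) < 1 + s := by linarith
  refine hF.mem_of_add_smul_mem (r := 1 / (1 + s)) hy hs
    ⟨by positivity, by rw [div_lt_one h1]; linarith⟩ ?_
  convert hxF using 1
  have : 1 / (1 + s) * (1 + s) = 1 := by field_simp
  linear_combination (norm := module) this • (x - y)

/-- The points of the face `F` of `T` that lie in no smaller face. -/
def faceInterior (T F : Set (EuclideanSpace ℝ (Fin m))) : Set (EuclideanSpace ℝ (Fin m)) :=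
  {x ∈ F | ∀ G, IsFace T G → x ∈ G → F ⊆ G}

theorem faceInterior_subset : faceInterior T F ⊆ F := fun _ hx => hx.1

theorem add_smul_sub_mem_faceInterior (hT : Convex ℝ T) (hF : IsFace T F)
    (hx : x ∈ faceInterior T F) (hy : y ∈ F) {r : ℝ} (hr : r ∈ Ico 0 1) :
    x + r • (y - x) ∈ faceInterior T F := by
  rcases hr.1.eq_or_lt with rfl | hr0
  · simpa using hx
  refine ⟨(hF.isExposed.convex hT).add_smul_sub_mem hx.1 hy ⟨hr.1, hr.2.le⟩, fun G hG h => ?_⟩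
  exact hx.2 G hG
    (hG.mem_of_add_smul_mem (hF.subset hx.1) (hF.subset hy) ⟨hr0, hr.2⟩ h)

variable {V : Finset (EuclideanSpace ℝ (Fin m))}

theorem IsFace.eq_convexHull (hF : IsFace (convexHull ℝ ↑V) F) :
    F = convexHull ℝ (↑V ∩ F) := by
  have hc : Convex ℝ F := hF.isExposed.convex (convex_convexHull ℝ _)
  have hK : IsCompact F := hF.isExposed.isCompact (V.finite_toSet.isCompact_convexHull (𝕜 := ℝ))
  refine Subset.antisymm ?_ (convexHull_min inter_subset_right hc)
  refine (closure_convexHull_extremePoints hK hc).symm.subset.trans ?_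
  refine closure_minimal (convexHull_mono (subset_inter ?_ extremePoints_subset))
    ((V.finite_toSet.inter_of_left F).isClosed_convexHull (𝕜 := ℝ))
  exact hF.isExposed.isExtreme.extremePoints_subset_extremePoints.trans
    extremePoints_convexHull_subset

theorem finite_setOf_isFace (V : Finset (EuclideanSpace ℝ (Fin m))) :
    {F | IsFace (convexHull ℝ (V : Set (EuclideanSpace ℝ (Fin m)))) F}.Finite := by
  refine (V.finite_toSet.powerset.image (convexHull ℝ)).subset fun F hF => ?_
  exact ⟨↑V ∩ F, inter_subset_left, (IsFace.eq_convexHull hF).symm⟩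

theorem IsFace.faceInterior_nonempty (hF : IsFace (convexHull ℝ ↑V) F) (hne : F.Nonempty) :
    (faceInterior (convexHull ℝ ↑V) F).Nonempty := by
  suffices h : ∀ 𝒢 : Finset (Set (EuclideanSpace ℝ (Fin m))),
      (∀ G ∈ 𝒢, IsFace (convexHull ℝ ↑V) G) → ∃ x ∈ F, ∀ G ∈ 𝒢, x ∈ G → F ⊆ G by
    obtain ⟨x, hx, h⟩ := h (finite_setOf_isFace V).toFinset (by simp)
    exact ⟨x, hx, fun G hG => h G (by simpa using hG)⟩
  intro 𝒢 h𝒢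
  induction 𝒢 using Finset.induction_on with
  | empty => exact ⟨hne.some, hne.some_mem, by simp⟩
  | insert G 𝒢 _ ih =>
    simp only [Finset.forall_mem_insert] at h𝒢 ⊢
    obtain ⟨x, hx, hx𝒢⟩ := ih h𝒢.2
    by_cases hFG : F ⊆ G
    · exact ⟨x, hx, fun _ => hFG, hx𝒢⟩
    obtain ⟨y, hy, hyG⟩ := not_subset.1 hFG
    have hz : x + (1 / 2 : ℝ) • (y - x) = y + (1 / 2 : ℝ) • (x - y) := by module
    refine ⟨x + (1 / 2 : ℝ) • (y - x),
      (hF.isExposed.convex (convex_convexHull ℝ _)).add_smul_sub_mem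
      hx hy ⟨by norm_num, by norm_num⟩, fun h => ?_, fun G' hG' h => hx𝒢 G' hG' ?_⟩
    · rw [hz] at h
      exact absurd (h𝒢.1.mem_of_add_smul_mem (hF.subset hy) (hF.subset hx)
        ⟨by norm_num, by norm_num⟩ h) hyG
    · exact (h𝒢.2 G' hG').mem_of_add_smul_mem (hF.subset hx) (hF.subset hy)
        ⟨by norm_num, by norm_num⟩ h

theorem IsFace.exists_prolong (hF : IsFace (convexHull ℝ ↑V) F)
    (hx : x ∈ faceInterior (convexHull ℝ ↑V) F) (hy : y ∈ F) :
    ∃ s : ℝ, 0 < s ∧ x + s • (x - y) ∈ F := by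
  obtain h | ⟨f, hf, z, hz, hfz⟩ := exists_prolong_or_exists_supporting
    (hF.isExposed.convex (convex_convexHull ℝ _)) hx.1
  · exact h y hy
  exfalso
  obtain ⟨l, hl⟩ := hF.isExposed ⟨x, hx.1⟩
  have hxl := hx.1
  rw [hl] at hxl
  obtain ⟨N, hN, hN0⟩ : ∃ N : ℝ, (∀ v ∈ V, l v < l x → f v + N * l v ≤ f x + N * l x) ∧ 0 ≤ N := by
    refine (((V.eventually_all).2 fun v _ => ?_).and (eventually_ge_atTop (0 : ℝ))).exists
    by_cases hv : l v < l x
    · filter_upwards [eventually_gt_atTop ((f v - f x) / (l x - l v))] with N hN _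
      rw [div_lt_iff₀ (by linarith)] at hN
      linarith
    · exact Eventually.of_forall fun _ h => absurd h hv
  let g := f + N • l
  have hg : ∀ w ∈ convexHull ℝ (V : Set (EuclideanSpace ℝ (Fin m))), g w ≤ g x := by
    refine convexHull_min (fun v hv => ?_)
      (convex_halfSpace_le (f := g) g.toLinearMap.isLinear (g x))
    change f v + N * l v ≤ f x + N * l x
    have hvT := subset_convexHull ℝ _ hv
    rcases (hxl.2 v hvT).lt_or_eq with h | h
    · exact hN v hv h
    · have hvF : v ∈ F := by
        rw [hl]
        exact ⟨hvT, fun y hy => (hxl.2 y hy).trans_eq h.symm⟩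
      rw [h]
      linarith [hf v hvF]
  have hG : IsFace (convexHull ℝ (V : Set (EuclideanSpace ℝ (Fin m)))) (g.toExposed _) :=
    (isFace_iff_isExposed ⟨x, hxl.1⟩).2 ⟨⟨x, hxl.1, hg⟩, ContinuousLinearMap.toExposed.isExposed⟩
  have hzG := hx.2 _ hG ⟨hxl.1, hg⟩ hz
  have h1 : f x + N * l x ≤ f z + N * l z := hzG.2 x hxl.1
  have h2 := mul_le_mul_of_nonneg_left (hxl.2 z hzG.1) hN0
  linarith

theorem IsFace.eventually_prolong (hF : IsFace (convexHull ℝ ↑V) F)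
    (hx : x ∈ faceInterior (convexHull ℝ ↑V) F) (hy : y ∈ F) :
    ∀ᶠ s in 𝓝[>] (0 : ℝ), x + s • (x - y) ∈ faceInterior (convexHull ℝ ↑V) F := by
  obtain ⟨s₀, hs₀, hs₀F⟩ := hF.exists_prolong hx hy
  filter_upwards [Ioo_mem_nhdsGT hs₀] with s hs
  convert add_smul_sub_mem_faceInterior (convex_convexHull ℝ _) hF hx hs₀F (r := s / s₀)
    ⟨(div_pos hs.1 hs₀).le, (div_lt_one hs₀).2 hs.2⟩ using 1
  rw [add_sub_cancel_left, smul_smul, div_mul_cancel₀ _ hs₀.ne']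

theorem exists_mem_faceInterior (hx : x ∈ convexHull ℝ (V : Set (EuclideanSpace ℝ (Fin m)))) :
    ∃ F, IsFace (convexHull ℝ ↑V) F ∧ x ∈ faceInterior (convexHull ℝ ↑V) F := by
  let 𝒢 := (finite_setOf_isFace V).toFinset.filter (x ∈ ·)
  have h𝒢 : ∀ G, G ∈ 𝒢 ↔ IsFace (convexHull ℝ ↑V) G ∧ x ∈ G := fun G => by simp [𝒢]
  have hx𝒢 : x ∈ ⋂₀ (𝒢 : Set (Set (EuclideanSpace ℝ (Fin m)))) :=
    fun G hG => ((h𝒢 G).1 hG).2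
  refine ⟨⋂₀ (𝒢 : Set (Set (EuclideanSpace ℝ (Fin m)))), (isFace_iff_isExposed ⟨x, hx⟩).2
    ⟨⟨x, hx𝒢⟩, IsExposed.sInter ⟨_, (h𝒢 _).2 ⟨.inl rfl, hx⟩⟩ fun G hG => ?_⟩, hx𝒢,
    fun G hG hxG => sInter_subset_of_mem ((h𝒢 G).2 ⟨hG, hxG⟩)⟩
  exact ((h𝒢 G).1 hG).1.isExposed

theorem faceInterior_unique (hF : IsFace T F) (hG : IsFace T G) (hxF : x ∈ faceInterior T F)
    (hxG : x ∈ faceInterior T G) : F = G :=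
  (hxF.2 G hG hxG.1).antisymm (hxG.2 F hF hxF.1)


theorem tendsto_add_smul_nhdsGT {E : Type*} [AddCommGroup E] [Module ℝ E] [TopologicalSpace E]
    [ContinuousAdd E] [ContinuousSMul ℝ E] (x w : E) :
    Tendsto (fun s : ℝ => x + s • w) (𝓝[>] 0) (𝓝 x) := by
  have hcont : Continuous fun s : ℝ => x + s • w := by fun_prop
  exact (hcont.tendsto' 0 x (by simp)).mono_left nhdsWithin_le_nhds

variable {U : Set (EuclideanSpace ℝ (Fin m))}

theorem IsFace.faceInterior_inter_nonempty (hF : IsFace (convexHull ℝ ↑V) F) (hU : IsOpen U)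
    (hFU : (F ∩ U).Nonempty) : (faceInterior (convexHull ℝ ↑V) F ∩ U).Nonempty := by
  obtain ⟨x, hxF, hxU⟩ := hFU
  obtain ⟨z, hz⟩ := hF.faceInterior_nonempty ⟨x, hxF⟩
  obtain ⟨s, hs, hs0, hs1⟩ := (((tendsto_add_smul_nhdsGT x (z - x)).eventually
    (hU.mem_nhds hxU)).and (Ioo_mem_nhdsGT (zero_lt_one' ℝ))).exists
  refine ⟨_, ?_, hs⟩
  convert add_smul_sub_mem_faceInterior (convex_convexHull ℝ _) hF hz hxF (r := 1 - s)
    ⟨by linarith, by linarith⟩ using 1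
  module

theorem IsFace.isRelOpenConvex (hF : IsFace (convexHull ℝ ↑V) F) (hU : IsOpen U)
    (hUc : Convex ℝ U) (hFU : (F ∩ U).Nonempty) :
    IsRelOpenConvex (faceInterior (convexHull ℝ ↑V) F ∩ U) where
  nonempty := hF.faceInterior_inter_nonempty hU hFU
  convex := by
    refine Convex.inter (convex_iff_openSegment_subset.2 fun x hx y hy => ?_) hUc
    rw [openSegment_eq_image']
    rintro _ ⟨r, hr, rfl⟩
    exact add_smul_sub_mem_faceInterior (convex_convexHull ℝ _) hF hx hy.1 ⟨hr.1.le, hr.2⟩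
  prolong x hx y hy := (hF.eventually_prolong hx.1 hy.1.1).and
    ((tendsto_add_smul_nhdsGT x (x - y)).eventually (hU.mem_nhds hx.2))
  bounded φ := by
    obtain ⟨C, hC⟩ := (V.finite_toSet.isCompact_convexHull (𝕜 := ℝ)).exists_bound_of_continuousOn
      (LinearMap.toContinuousLinearMap φ).continuous.continuousOn
    exact ⟨C, fun x hx => hC x (hF.subset hx.1.1)⟩

theorem IsFace.finrank_vectorSpan_faceInterior_inter (hF : IsFace (convexHull ℝ ↑V) F)
    (hU : IsOpen U) (hFU : (F ∩ U).Nonempty) :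
    Module.finrank ℝ (vectorSpan ℝ (faceInterior (convexHull ℝ ↑V) F ∩ U)) = adim F := by
  suffices h : vectorSpan ℝ F ≤ vectorSpan ℝ (faceInterior (convexHull ℝ ↑V) F ∩ U) by
    rw [adim, direction_affineSpan,
      h.antisymm (vectorSpan_mono ℝ (inter_subset_left.trans faceInterior_subset))]
  obtain ⟨x, hx⟩ := hF.faceInterior_inter_nonempty hU hFU
  rw [vectorSpan_eq_span_vsub_set_right ℝ hx.1.1, Submodule.span_le]
  rintro _ ⟨y, hy, rfl⟩
  obtain ⟨s, hs, hs0, hs1⟩ := (((tendsto_add_smul_nhdsGT x (y - x)).eventually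
    (hU.mem_nhds hx.2)).and (Ioo_mem_nhdsGT (zero_lt_one' ℝ))).exists
  have h := vsub_mem_vectorSpan ℝ (s := faceInterior (convexHull ℝ ↑V) F ∩ U)
    ⟨add_smul_sub_mem_faceInterior (convex_convexHull ℝ _) hF hx.1 hy ⟨hs0.le, hs1⟩, hs⟩ hx
  rw [vsub_eq_sub, add_sub_cancel_left] at h
  simpa [hs0.ne'] using (vectorSpan ℝ _).smul_mem s⁻¹ h

theorem sum_ind_faceInterior (V : Finset (EuclideanSpace ℝ (Fin m)))
    (x : EuclideanSpace ℝ (Fin m)) :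
    ∑ F ∈ (finite_setOf_isFace V).toFinset, ind (faceInterior (convexHull ℝ ↑V) F) x =
      ind (convexHull ℝ ↑V) x := by
  by_cases hx : x ∈ convexHull ℝ (V : Set (EuclideanSpace ℝ (Fin m)))
  · obtain ⟨F, hF, hxF⟩ := exists_mem_faceInterior hx
    rw [Finset.sum_eq_single_of_mem F (by simpa using hF), ind_of_mem hxF, ind_of_mem hx]
    intro G hG hGF
    exact ind_of_notMem fun hxG => hGF (faceInterior_unique (by simpa using hG) hF hxG hxF)
  · rw [ind_of_notMem hx]
    refine Finset.sum_eq_zero fun F hF => ind_of_notMem fun h => hx ?_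
    rw [Finite.mem_toFinset] at hF
    exact IsFace.subset hF h.1

theorem ind_inter {α : Type*} (s t : Set α) (x : α) : ind (s ∩ t) x = ind s x * ind t x := by
  by_cases hs : x ∈ s <;> by_cases ht : x ∈ t <;> simp [ind, hs, ht]

/-- Around a boundary point of a compact convex body there are arbitrarily small convex open
sets meeting the body along half-open segments, in some fixed direction. -/
theorem exists_cylinder {E : Type*} [NormedAddCommGroup E] [NormedSpace ℝ E]
    [FiniteDimensional ℝ E] {T : Set E} (hT : Convex ℝ T) (hTc : IsCompact T)
    (hint : (interior T).Nonempty) {x : E} (hx : x ∈ T) (hxi : x ∉ interior T) {N : Set E}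
    (hN : N ∈ 𝓝 x) :
    ∃ (U : Set E) (v : E), IsOpen U ∧ Convex ℝ U ∧ x ∈ U ∧ U ⊆ N ∧ v ≠ 0 ∧
      ∀ q, HasEulerIntegral (fun s : ℝ => ind (T ∩ U) (q + s • v)) 0 := by
  obtain ⟨z, hz⟩ := hint
  have hv : z - x ≠ 0 := sub_ne_zero.2 fun h => hxi (h ▸ hz)
  set v := z - x with hvdef
  obtain ⟨φ', hφ'⟩ := Module.Projective.exists_dual_eq_one ℝ hv
  let φ : E →L[ℝ] ℝ := LinearMap.toContinuousLinearMap φ'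
  have hφ : φ v = 1 := hφ'
  obtain ⟨r, hr, hrN⟩ := Metric.mem_nhds_iff.1 hN
  have hnv : 0 < ‖v‖ := norm_pos_iff.2 hv
  obtain ⟨ε, hε0, hε1, hεr⟩ : ∃ ε : ℝ, 0 < ε ∧ ε < 1 ∧ ε * ‖v‖ < r / 2 := by
    have h : Tendsto (fun ε : ℝ => ε * ‖v‖) (𝓝[>] 0) (𝓝 0) := by
      have hcont : Continuous fun ε : ℝ => ε * ‖v‖ := by fun_prop
      exact (hcont.tendsto' 0 0 (by simp)).mono_left nhdsWithin_le_nhds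
    obtain ⟨ε, hε, h0, h1⟩ :=
      ((h.eventually (gt_mem_nhds (half_pos hr))).and (Ioo_mem_nhdsGT (zero_lt_one' ℝ))).exists
    exact ⟨ε, h0, h1, hε⟩
  have htop : x + ε • v ∈ interior T := by
    refine hT.openSegment_self_interior_subset_interior hx hz ?_
    rw [openSegment_eq_image']
    exact ⟨ε, ⟨hε0, hε1⟩, rfl⟩
  have hbot : x + (-ε) • v ∉ T := fun h => by
    refine hxi (hT.openSegment_self_interior_subset_interior h hz ?_)
    rw [openSegment_eq_image']
    refine ⟨ε / (1 + ε), ⟨by positivity, by rw [div_lt_one (by linarith)]; linarith⟩, ?_⟩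
    have h1 : ε / (1 + ε) * (1 + ε) = ε := by field_simp
    have h2 : z = x + v := by rw [hvdef]; abel
    rw [h2]
    linear_combination (norm := module) h1 • v
  obtain ⟨δ₁, hδ₁, hδ₁T⟩ := Metric.mem_nhds_iff.1 (mem_interior_iff_mem_nhds.1 htop)
  obtain ⟨δ₂, hδ₂, hδ₂T⟩ := Metric.mem_nhds_iff.1 (hTc.isClosed.isOpen_compl.mem_nhds hbot)
  let δ := min (r / 2) (min δ₁ δ₂)
  have hδ : 0 < δ := by positivity
  let π : E →L[ℝ] E := ContinuousLinearMap.id ℝ E - φ.smulRight v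
  have hπ : ∀ y, π y = y - φ y • v := fun y => rfl
  have hπv : π v = 0 := by rw [hπ, hφ, one_smul, sub_self]
  let U : Set E := (fun p => -x + p) ⁻¹' (π ⁻¹' Metric.ball 0 δ ∩ φ ⁻¹' Set.Ioo (-ε) ε)
  have hmemU : ∀ p, p ∈ U ↔ ‖π (-x + p)‖ < δ ∧ φ (-x + p) ∈ Set.Ioo (-ε) ε := fun p => by
    simp [U]
  refine ⟨U, v, ?_, ?_, ?_, ?_, hv, fun q => ?_⟩
  · exact ((Metric.isOpen_ball.preimage π.continuous).inter
      (isOpen_Ioo.preimage φ.continuous)).preimage (by fun_prop)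
  · exact (((convex_ball 0 δ).linear_preimage π.toLinearMap).inter
      ((convex_Ioo (-ε) ε).linear_preimage φ.toLinearMap)).translate_preimage_right _
  · rw [hmemU]
    simp [hδ, hε0]
  · intro p hp
    rw [hmemU] at hp
    apply hrN
    rw [mem_ball_iff_norm']
    have h1 : p - x = π (-x + p) + φ (-x + p) • v := by rw [hπ]; abel
    have h2 : ‖φ (-x + p) • v‖ ≤ ε * ‖v‖ := by
      rw [norm_smul]
      gcongr
      exact (abs_lt.2 hp.2).le
    have h3 : δ ≤ r / 2 := min_le_left _ _
    rw [norm_sub_rev, h1]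
    linarith [norm_add_le (π (-x + p)) (φ (-x + p) • v), hp.1]
  · have hπq : ∀ s : ℝ, π (-x + (q + s • v)) = π (-x + q) := fun s => by
      rw [← add_assoc, map_add, map_smul, hπv, smul_zero, add_zero]
    have hφq : ∀ s : ℝ, φ (-x + (q + s • v)) = φ (-x + q) + s := fun s => by
      rw [← add_assoc, map_add, map_smul, hφ, smul_eq_mul, mul_one]
    set w := π (-x + q) with hw
    set a := φ (-x + q) with ha
    have hq : q = x + w + a • v := by rw [hw, hπ, ← ha]; abel
    by_cases hwδ : ‖w‖ < δ
    swap
    · have : ∀ s : ℝ, q + s • v ∉ T ∩ U := fun s h => by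
        have := ((hmemU _).1 h.2).1
        rw [hπq] at this
        exact hwδ this
      simpa [this] using HasEulerIntegral.zero
    have hεT : x + w + ε • v ∈ T := by
      apply hδ₁T
      rw [mem_ball_iff_norm, show x + w + ε • v - (x + ε • v) = w by abel]
      exact hwδ.trans_le ((min_le_right _ _).trans (min_le_left _ _))
    have hεT' : x + w + (-ε) • v ∉ T := by
      apply hδ₂T
      rw [mem_ball_iff_norm, show x + w + (-ε) • v - (x + (-ε) • v) = w by abel]
      exact hwδ.trans_le ((min_le_right _ _).trans (min_le_right _ _))
    let K : Set ℝ := {s | x + w + s • v ∈ T} ∩ Set.Icc (-ε) ε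
    have hKc : Convex ℝ K := (convex_setOf_add_smul_mem hT _ _).inter (convex_Icc _ _)
    have hKK : IsCompact K := by
      refine isCompact_Icc.inter_left (hTc.isClosed.preimage ?_)
      fun_prop
    have hεK : ε ∈ K := ⟨hεT, by linarith, le_rfl⟩
    obtain ⟨b, hb⟩ : ∃ b, K = Set.Icc b ε := by
      have h := eq_Icc_of_connected_compact ⟨⟨ε, hεK⟩, hKc.isPreconnected⟩ hKK
      refine ⟨sInf K, ?_⟩
      have : sSup K = ε := (IsGreatest.csSup_eq ⟨hεK, fun s hs => hs.2.2⟩)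
      rwa [this] at h
    have hfun : (fun s : ℝ => ind (T ∩ U) (q + s • v)) = ind (Set.Ico (b - a) (ε - a)) := by
      have key : ∀ s : ℝ, q + s • v ∈ T ∩ U ↔ s ∈ Set.Ico (b - a) (ε - a) := fun s => by
        have e : q + s • v = x + w + (a + s) • v := by rw [hq]; module
        have hK1 : a + s ∈ K ↔ b ≤ a + s ∧ a + s ≤ ε := by rw [hb]; rfl
        have hK2 : a + s ∈ K ↔ x + w + (a + s) • v ∈ T ∧ -ε ≤ a + s ∧ a + s ≤ ε := Iff.rfl
        have h3 : a + s = -ε → x + w + (a + s) • v ∉ T := fun h => by rwa [h]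
        rw [mem_inter_iff, hmemU, hπq, hφq, e]
        simp only [hwδ, true_and, Set.mem_Ioo, Set.mem_Ico, sub_le_iff_le_add, lt_sub_iff_add_lt,
          add_comm s a]
        constructor
        · rintro ⟨h, h1, h2⟩
          exact ⟨(hK1.1 (hK2.2 ⟨h, h1.le, h2.le⟩)).1, h2⟩
        · rintro ⟨h1, h2⟩
          obtain ⟨h4, h5, -⟩ := hK2.1 (hK1.2 ⟨h1, h2.le⟩)
          exact ⟨h4, lt_of_le_of_ne h5 fun h => h3 h.symm h4, h2⟩
      exact funext fun s => ind_congr (key s)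
    rw [hfun]
    exact HasEulerIntegral.Ico _ _

theorem adim_eq_of_nonempty_interior (hT : (interior T).Nonempty) : adim T = m := by
  rw [adim, affineSpan_eq_top_of_nonempty_interior, AffineSubspace.direction_top, finrank_top,
    finrank_euclideanSpace_fin]
  exact hT.mono (interior_mono (subset_convexHull ℝ T))

/-- The alternating sum of the indicators of the faces of a full-dimensional polytope is, up to
sign, the indicator of its interior. -/
theorem sum_neg_one_pow_adim_mul_ind
    (hint : (interior (convexHull ℝ (V : Set (EuclideanSpace ℝ (Fin m))))).Nonempty)
    (x : EuclideanSpace ℝ (Fin m)) :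
    ∑ F ∈ (finite_setOf_isFace V).toFinset, (-1) ^ adim F * ind F x =
      (-1) ^ m * ind (interior (convexHull ℝ ↑V)) x := by
  set T := convexHull ℝ (V : Set (EuclideanSpace ℝ (Fin m))) with hTdef
  have hTc : IsCompact T := V.finite_toSet.isCompact_convexHull (𝕜 := ℝ)
  have hT : Convex ℝ T := convex_convexHull ℝ _
  by_cases hxi : x ∈ interior T
  · rw [ind_of_mem hxi, Finset.sum_eq_single_of_mem T
      ((finite_setOf_isFace V).mem_toFinset.2 (.inl rfl)),
      adim_eq_of_nonempty_interior hint, ind_of_mem (interior_subset hxi)]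
    intro F hF hFT
    rw [Finite.mem_toFinset] at hF
    rw [ind_of_notMem fun hxF => hFT (IsFace.eq_of_mem_interior hF hxi hxF), mul_zero]
  rw [ind_of_notMem hxi, mul_zero]
  by_cases hx : x ∈ T
  swap
  · refine Finset.sum_eq_zero fun F hF => ?_
    rw [Finite.mem_toFinset] at hF
    rw [ind_of_notMem fun hxF => hx (IsFace.subset hF hxF), mul_zero]
  let 𝒢 := (finite_setOf_isFace V).toFinset.filter (x ∈ ·)
  have h𝒢 : ∀ {G}, G ∈ 𝒢 ↔ IsFace T G ∧ x ∈ G := by simp [𝒢, hTdef]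
  have hN : ∀ᶠ p in 𝓝 x, ∀ F ∈ (finite_setOf_isFace V).toFinset, x ∉ F → p ∉ F := by
    rw [Finset.eventually_all]
    intro F hF
    rw [Finite.mem_toFinset] at hF
    by_cases hxF : x ∈ F
    · simp [hxF]
    · filter_upwards [(IsExposed.isCompact (IsFace.isExposed hF) hTc).isClosed.isOpen_compl.mem_nhds
        hxF] with p hp _ using hp
  obtain ⟨U, v, hU, hUc, hxU, hUN, hv, hline⟩ := exists_cylinder hT hTc hint hx hxi hN
  have hFU : ∀ F ∈ 𝒢, (F ∩ U).Nonempty := fun F hF => ⟨x, (h𝒢.1 hF).2, hxU⟩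
  have key := sum_mul_neg_one_pow_finrank_eq_zero_of_lines 𝒢 (fun _ => 1)
    (S := fun F => faceInterior T F ∩ U)
    (fun F hF => (h𝒢.1 hF).1.isRelOpenConvex hU hUc (hFU F hF)) hv fun q => by
      convert hline q using 2 with s
      set p := q + s • v
      simp only [one_mul, ind_inter, ← Finset.sum_mul]
      by_cases hp : p ∈ U
      swap
      · simp [hp]
      congr 1
      rw [← sum_ind_faceInterior]
      refine Finset.sum_subset (Finset.filter_subset _ _) fun F hF hF𝒢 => ?_
      refine ind_of_notMem fun hpF => hUN hp F hF (fun hxF => hF𝒢 ?_) hpF.1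
      exact Finset.mem_filter.2 ⟨hF, hxF⟩
  rw [← key, Finset.sum_filter]
  refine Finset.sum_congr rfl fun F hF => ?_
  split_ifs with hxF
  · have hF𝒢 : F ∈ 𝒢 := Finset.mem_filter.2 ⟨hF, hxF⟩
    rw [(h𝒢.1 hF𝒢).1.finrank_vectorSpan_faceInterior_inter hU (hFU F hF𝒢), ind_of_mem hxF]
    ring
  · rw [ind_of_notMem hxF, mul_zero]


/-! ### Sections by affine subspaces -/

/-- The affine subspaces that intersect a given set. -/
def affineTransversals (S : Set (EuclideanSpace ℝ (Fin m))) :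
    Set (AffineSubspace ℝ (EuclideanSpace ℝ (Fin m))) :=
  {L | (S ∩ L).Nonempty}

/-- A positive-dimensional affine subspace is sliced into affine subspaces of one dimension less
by the level sets of a linear form. -/
theorem exists_slices {k E : Type*} [Field k] [AddCommGroup E] [Module k E]
    [FiniteDimensional k E] {L : AffineSubspace k E} (hL : (L : Set E).Nonempty) {j : ℕ}
    (hj : Module.finrank k L.direction = j + 1) :
    ∃ (g : E →ₗ[k] k) (M : k → AffineSubspace k E), (∃ v ∈ L.direction, g v = 1) ∧
      ∀ t, (M t : Set E).Nonempty ∧ Module.finrank k (M t).direction = j ∧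
        ∀ x, x ∈ M t ↔ x ∈ L ∧ g x = t := by
  obtain ⟨p, hp⟩ := hL
  have hne : L.direction ≠ ⊥ := fun h => by
    rw [h, finrank_bot] at hj
    omega
  obtain ⟨v, hv, hv0⟩ := Submodule.exists_mem_ne_zero_of_ne_bot hne
  obtain ⟨g, hg⟩ := Module.Projective.exists_dual_eq_one k hv0
  refine ⟨g, fun t => AffineSubspace.mk' (p + (t - g p) • v) (L.direction ⊓ LinearMap.ker g),
    ⟨v, hv, hg⟩, fun t => ⟨⟨_, AffineSubspace.self_mem_mk' _ _⟩, ?_, fun x => ?_⟩⟩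
  · rw [AffineSubspace.direction_mk', ← Submodule.map_comap_subtype,
      Submodule.finrank_map_subtype_eq]
    have h0 : g.comp L.direction.subtype ≠ 0 := fun h => by
      have := LinearMap.congr_fun h ⟨v, hv⟩
      simp [hg] at this
    have := Module.Dual.finrank_ker_add_one_of_ne_zero h0
    rw [LinearMap.ker_comp] at this
    omega
  · have hpv : p + (t - g p) • v ∈ L := by
      rw [add_comm]
      exact AffineSubspace.vadd_mem_of_mem_direction (L.direction.smul_mem _ hv) hp
    rw [AffineSubspace.mem_mk', Submodule.mem_inf,
      AffineSubspace.vsub_right_mem_direction_iff_mem hpv, LinearMap.mem_ker, vsub_eq_sub,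
      map_sub, map_add, map_smul, hg, smul_eq_mul, mul_one,
      add_sub_cancel, sub_eq_zero]

theorem ind_affineTransversals_slice {L N : AffineSubspace ℝ (EuclideanSpace ℝ (Fin m))}
    {g : EuclideanSpace ℝ (Fin m) →ₗ[ℝ] ℝ} {t : ℝ} (hN : ∀ x, x ∈ N ↔ x ∈ L ∧ g x = t)
    (S : Set (EuclideanSpace ℝ (Fin m))) :
    ind (affineTransversals S) N = ind (g '' (S ∩ L)) t := by
  refine ind_congr ⟨?_, ?_⟩
  · rintro ⟨x, hxS, hx⟩
    obtain ⟨hxL, rfl⟩ := (hN x).1 hx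
    exact ⟨x, ⟨hxS, hxL⟩, rfl⟩
  · rintro ⟨x, ⟨hxS, hxL⟩, rfl⟩
    exact ⟨x, hxS, (hN x).2 ⟨hxL, rfl⟩⟩

theorem hasEulerIntegral_image_of_isCompact {S : Set (EuclideanSpace ℝ (Fin m))}
    (hS : Convex ℝ S) (hSc : IsCompact S) (L : AffineSubspace ℝ (EuclideanSpace ℝ (Fin m)))
    (g : EuclideanSpace ℝ (Fin m) →ₗ[ℝ] ℝ) :
    HasEulerIntegral (ind (g '' (S ∩ L))) (ind (affineTransversals S) L) := by
  by_cases hne : (S ∩ L : Set (EuclideanSpace ℝ (Fin m))).Nonempty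
  · rw [ind_of_mem (show L ∈ affineTransversals S from hne)]
    exact .of_isCompact ((hS.inter L.convex).linear_image g)
      ((hSc.inter_right L.closed_of_finiteDimensional).image
        (LinearMap.toContinuousLinearMap g).continuous) (hne.image g)
  · rw [ind_of_notMem (show L ∉ affineTransversals S from hne), not_nonempty_iff_eq_empty.1 hne,
      image_empty]
    convert HasEulerIntegral.zero with t
    exact ind_of_notMem (notMem_empty t)

theorem hasEulerIntegral_image_of_isOpen {S : Set (EuclideanSpace ℝ (Fin m))}
    (hS : Convex ℝ S) (hSo : IsOpen S) (hSb : Bornology.IsBounded S)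
    {L : AffineSubspace ℝ (EuclideanSpace ℝ (Fin m))} {g : EuclideanSpace ℝ (Fin m) →ₗ[ℝ] ℝ}
    {v : EuclideanSpace ℝ (Fin m)} (hv : v ∈ L.direction) (hgv : g v = 1) :
    HasEulerIntegral (ind (g '' (S ∩ L))) (-ind (affineTransversals S) L) := by
  by_cases hne : (S ∩ L : Set (EuclideanSpace ℝ (Fin m))).Nonempty
  · have hb : Bornology.IsBounded (g '' (S ∩ L)) :=
      (LinearMap.toContinuousLinearMap g).lipschitz.isBounded_image (hSb.subset inter_subset_left)
    rw [ind_of_mem (show L ∈ affineTransversals S from hne)]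
    refine .of_isOpen ((hS.inter L.convex).linear_image g) (isOpen_iff_mem_nhds.2 ?_)
      (hne.image g) hb.bddBelow hb.bddAbove
    rintro _ ⟨x, ⟨hxS, hxL⟩, rfl⟩
    have hcont : Continuous fun t : ℝ => x + (t - g x) • v := by fun_prop
    filter_upwards [hcont.continuousAt.preimage_mem_nhds
      (hSo.mem_nhds (by simpa using hxS))] with t ht
    refine ⟨x + (t - g x) • v, ⟨ht, ?_⟩, by simp [hgv]⟩
    rw [SetLike.mem_coe, add_comm]
    exact AffineSubspace.vadd_mem_of_mem_direction (L.direction.smul_mem _ hv) hxL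
  · rw [ind_of_notMem (show L ∉ affineTransversals S from hne), not_nonempty_iff_eq_empty.1 hne,
      image_empty, neg_zero]
    convert HasEulerIntegral.zero with t
    exact ind_of_notMem (notMem_empty t)

theorem sum_neg_one_pow_adim_mul_ind_affineTransversals
    (hint : (interior (convexHull ℝ (V : Set (EuclideanSpace ℝ (Fin m))))).Nonempty)
    {L : AffineSubspace ℝ (EuclideanSpace ℝ (Fin m))}
    (hL : (L : Set (EuclideanSpace ℝ (Fin m))).Nonempty) :
    ∑ F ∈ (finite_setOf_isFace V).toFinset, (-1) ^ adim F * ind (affineTransversals F) L =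
      (-1) ^ (m + Module.finrank ℝ L.direction) *
        ind (affineTransversals (interior (convexHull ℝ ↑V))) L := by
  induction hj : Module.finrank ℝ L.direction generalizing L with
  | zero =>
    obtain ⟨x, hx⟩ := hL
    have hL : ∀ S, ind (affineTransversals S) L = ind S x := fun S => by
      refine ind_congr ⟨?_, fun h => ⟨x, h, hx⟩⟩
      rintro ⟨y, hyS, hy⟩
      have := AffineSubspace.vsub_mem_direction hy hx
      rw [Submodule.finrank_eq_zero.1 hj, Submodule.mem_bot, vsub_eq_zero_iff_eq] at this
      exact this ▸ hyS
    simp only [hL]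
    exact sum_neg_one_pow_adim_mul_ind hint x
  | succ j ih =>
    have hTc : IsCompact (convexHull ℝ (V : Set (EuclideanSpace ℝ (Fin m)))) :=
      V.finite_toSet.isCompact_convexHull (𝕜 := ℝ)
    have hT := convex_convexHull ℝ (V : Set (EuclideanSpace ℝ (Fin m)))
    obtain ⟨g, M, ⟨v, hv, hgv⟩, hM⟩ := exists_slices hL hj
    have hl := HasEulerIntegral.sum (finite_setOf_isFace V).toFinset
      (f := fun F t => (-1) ^ adim F * ind (affineTransversals F) (M t))
      (a := fun F => (-1) ^ adim F * ind (affineTransversals F) L) fun F hF => by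
        rw [Finite.mem_toFinset] at hF
        simp only [fun t => ind_affineTransversals_slice (hM t).2.2 F]
        exact (hasEulerIntegral_image_of_isCompact ((IsFace.isExposed hF).convex hT)
          ((IsFace.isExposed hF).isCompact hTc) L g).const_mul _
    have hr := (hasEulerIntegral_image_of_isOpen hT.interior isOpen_interior
      (hTc.isBounded.subset interior_subset) hv hgv).const_mul ((-1) ^ (m + j))
    simp only [fun t => ih (hM t).1 (hM t).2.1] at hl
    simp only [fun t => ind_affineTransversals_slice (hM t).2.2] at hl
    rw [hl.unique hr]
    ring

end Faces

/-- **Generalized Euler relation** (Theorem 1.3). Let `T ⊆ ℝ^m` be a polytope with non-empty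
interior and `L` an affine subspace of dimension `m - d`. Denoting by `a_k` the number of
`k`-dimensional faces of `T` intersected by `L`, the alternating sum `Σ (−1)^k a_k` equals
`(−1)^d` if `L` meets the interior of `T`, and `0` otherwise. -/
theorem generalized_euler_relation (m d : ℕ) (hd : d ≤ m)
    (T : Set (EuclideanSpace ℝ (Fin m)))
    (hT : ∃ V : Finset (EuclideanSpace ℝ (Fin m)), T = convexHull ℝ ↑V)
    (hTint : (interior T).Nonempty)
    (L : AffineSubspace ℝ (EuclideanSpace ℝ (Fin m)))
    (hL : (L : Set (EuclideanSpace ℝ (Fin m))).Nonempty)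
    (hLdim : Module.finrank ℝ L.direction = m - d) :
    ∑ k ∈ Finset.range (m + 1), (-1 : ℤ) ^ k *
        ({F : Set (EuclideanSpace ℝ (Fin m)) |
            IsFace T F ∧ adim F = k ∧ (F ∩ ↑L).Nonempty}.ncard : ℤ)
      = if ((↑L : Set (EuclideanSpace ℝ (Fin m))) ∩ interior T).Nonempty
          then (-1 : ℤ) ^ d else 0 := by
  obtain ⟨V, rfl⟩ := hT
  have hadim : ∀ F : Set (EuclideanSpace ℝ (Fin m)), adim F ∈ Finset.range (m + 1) := fun F => by
    rw [Finset.mem_range, Nat.lt_succ_iff]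
    exact (Submodule.finrank_le _).trans finrank_euclideanSpace_fin.le
  have hcount : ∀ k, (({F : Set (EuclideanSpace ℝ (Fin m)) |
      IsFace (convexHull ℝ ↑V) F ∧ adim F = k ∧ (F ∩ ↑L).Nonempty}.ncard : ℕ) : ℤ) =
      ∑ F ∈ (finite_setOf_isFace V).toFinset with adim F = k, ind (affineTransversals F) L := by
    intro k
    simp only [ind, Finset.sum_boole, Finset.filter_filter]
    rw [← Set.ncard_coe_finset]
    congr 2
    ext F
    rw [Finset.mem_coe, Finset.mem_filter, Finite.mem_toFinset]
    rfl
  calc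
    _ = ∑ k ∈ Finset.range (m + 1), ∑ F ∈ (finite_setOf_isFace V).toFinset with adim F = k,
        (-1) ^ adim F * ind (affineTransversals F) L := by
      refine Finset.sum_congr rfl fun k _ => ?_
      rw [hcount, Finset.mul_sum]
      exact Finset.sum_congr rfl fun F hF => by rw [(Finset.mem_filter.1 hF).2]
    _ = (-1) ^ (m + (m - d)) * ind (affineTransversals (interior (convexHull ℝ ↑V))) L := by
      rw [Finset.sum_fiberwise_of_maps_to fun F _ => hadim F,
        sum_neg_one_pow_adim_mul_ind_affineTransversals hTint hL, hLdim]
    _ = _ := by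
      have hpow : (-1 : ℤ) ^ (m + (m - d)) = (-1) ^ d := by
        rw [show m + (m - d) = 2 * (m - d) + d by omega, pow_add, pow_mul, neg_one_sq, one_pow,
          one_mul]
      rw [hpow, inter_comm]
      split_ifs with h
      · rw [ind_of_mem (show L ∈ affineTransversals _ from h), mul_one]
      · rw [ind_of_notMem (show L ∉ affineTransversals _ from h), mul_zero]
end

section
/- Let T be a polytope in ℝ^m with non-empty interior. Then, as a pointwise identity of functions on ℝ^m, 𝟙_{int T} = Σ_{k=0}^{m} (−1)^k Σ_{F ∈ 𝓕_{m−k}(T)} 𝟙_F, where 𝓕_j(T) denotes the set of j-dimensional faces of T (with 𝓕_m(T) = {T}). -/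
open scoped Classical
open Pointwise

section OpenCones

open Topology Filter Module Submodule

variable {X : Type*} [AddCommGroup X] [Module ℝ X]

/-- A convex cone that is open relative to its linear span. -/
structure IsRelOpenCone (D : Set X) : Prop where
  add_mem : ∀ ⦃u⦄, u ∈ D → ∀ ⦃v⦄, v ∈ D → u + v ∈ D
  smul_mem : ∀ ⦃c : ℝ⦄, 0 < c → ∀ ⦃v⦄, v ∈ D → c • v ∈ D
  eventually_mem : ∀ ⦃z⦄, z ∈ D → ∀ ⦃y⦄, y ∈ span ℝ D → ∀ᶠ t in 𝓝[>] (0 : ℝ), z + t • y ∈ D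

/-- The part of `D` on which the functional `g` has sign `s`. -/
def signPart (g : Dual ℝ X) (s : SignType) (D : Set X) : Set X :=
  D ∩ {v | SignType.sign (g v) = s}

/-- The Euler characteristic of a relatively open cone. -/
noncomputable def coneEuler (D : Set X) : ℤ :=
  if D.Nonempty then (-1) ^ finrank ℝ (span ℝ D) else 0

/-- The integral of `φ` against the Euler characteristic over the cells into which the
functionals in the list cut `D`; `φ` is evaluated at one point of each cell. -/
noncomputable def eulerSum : List (Dual ℝ X) → Set X → (X → ℤ) → ℤ
  | [], D, φ => if h : D.Nonempty then φ h.some * coneEuler D else 0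
  | g :: L, D, φ => ∑ s : SignType, eulerSum L (signPart g s D) φ

lemma signPart_subset (g : Dual ℝ X) (s : SignType) (D : Set X) : signPart g s D ⊆ D :=
  Set.inter_subset_left

lemma signPart_comm (g h : Dual ℝ X) (s t : SignType) (D : Set X) :
    signPart g s (signPart h t D) = signPart h t (signPart g s D) :=
  Set.inter_right_comm _ _ _

lemma isRelOpenCone_univ : IsRelOpenCone (Set.univ : Set X) :=
  ⟨fun _ _ _ _ => trivial, fun _ _ _ _ => trivial, fun _ _ _ _ => by simp⟩

lemma eventually_sign_add_mul {a b : ℝ} (h : a = 0 → b = 0) :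
    ∀ᶠ t in 𝓝[>] (0 : ℝ), SignType.sign (a + t * b) = SignType.sign a := by
  have hc : Tendsto (fun t : ℝ => a + t * b) (𝓝[>] 0) (𝓝 a) := by
    have : Continuous (fun t : ℝ => a + t * b) := by fun_prop
    simpa using (this.tendsto 0).mono_left nhdsWithin_le_nhds
  rcases lt_trichotomy a 0 with ha | ha | ha
  · filter_upwards [hc.eventually (gt_mem_nhds ha)] with t ht
    rw [sign_neg ha, sign_neg ht]
  · simp [h ha]
  · filter_upwards [hc.eventually (lt_mem_nhds ha)] with t ht
    rw [sign_pos ha, sign_pos ht]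

lemma IsRelOpenCone.signPart {D : Set X} (hD : IsRelOpenCone D) (g : Dual ℝ X) (s : SignType) :
    IsRelOpenCone (signPart g s D) := by
  refine ⟨?_, ?_, ?_⟩
  · rintro u ⟨hu, hus⟩ v ⟨hv, hvs⟩
    refine ⟨hD.add_mem hu hv, ?_⟩
    simp only [Set.mem_ofPred_eq, map_add] at *
    cases s
    · simp only [SignType.zero_eq_zero, sign_eq_zero_iff] at *
      linarith
    · simp only [SignType.neg_eq_neg_one, sign_eq_neg_one_iff] at *
      linarith
    · simp only [SignType.pos_eq_one, sign_eq_one_iff] at *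
      linarith
  · rintro c hc v ⟨hv, hvs⟩
    refine ⟨hD.smul_mem hc hv, ?_⟩
    simpa [sign_mul, sign_pos hc] using hvs
  · rintro z ⟨hz, hzs⟩ y hy
    have hyD : y ∈ span ℝ D := span_mono (signPart_subset g s D) hy
    have hzy : g z = 0 → g y = 0 := by
      intro h0
      have hs : s = 0 := by rw [← (show SignType.sign (g z) = s from hzs), h0, sign_zero]
      have : span ℝ (_root_.signPart g s D) ≤ LinearMap.ker g := by
        rw [span_le]
        rintro v ⟨-, hv⟩
        simpa [hs] using hv
      exact this hy
    filter_upwards [hD.eventually_mem hz hyD, eventually_sign_add_mul hzy] with t h1 h2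
    refine ⟨h1, ?_⟩
    simp only [Set.mem_ofPred_eq, map_add, map_smul, smul_eq_mul] at *
    rw [h2, hzs]

variable {D : Set X} {g : Dual ℝ X}

lemma IsRelOpenCone.span_signPart_of_ne_zero (hD : IsRelOpenCone D) {s : SignType} (hs : s ≠ 0)
    (hne : (_root_.signPart g s D).Nonempty) : span ℝ (_root_.signPart g s D) = span ℝ D := by
  apply le_antisymm (span_mono (signPart_subset g s D))
  rw [span_le]
  intro y hy
  obtain ⟨z, hz, hzs⟩ := hne
  have h0 : g z = 0 → g y = 0 := by
    intro h0
    refine absurd ?_ hs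
    rw [← (show SignType.sign (g z) = s from hzs), h0, sign_zero]
  obtain ⟨t, h1, h2, ht⟩ := ((hD.eventually_mem hz (subset_span hy)).and
    ((eventually_sign_add_mul h0).and self_mem_nhdsWithin)).exists
  have h3 : z + t • y ∈ span ℝ (_root_.signPart g s D) := subset_span ⟨h1, by
    simpa [hzs] using h2.trans hzs⟩
  have h4 : t • y ∈ span ℝ (_root_.signPart g s D) := by
    simpa using sub_mem h3 (subset_span ⟨hz, hzs⟩)
  exact (smul_mem_iff _ (ne_of_gt ht)).1 h4

lemma IsRelOpenCone.span_signPart_zero (hD : IsRelOpenCone D)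
    (hne : (_root_.signPart g 0 D).Nonempty) :
    span ℝ (_root_.signPart g 0 D) = span ℝ D ⊓ LinearMap.ker g := by
  apply le_antisymm
  · rw [span_le]
    rintro v ⟨hv, hv0⟩
    exact ⟨subset_span hv, by simpa using hv0⟩
  · rintro y ⟨hy, hgy⟩
    obtain ⟨z, hz, hzs⟩ := hne
    have hgy : g y = 0 := hgy
    have hgz : g z = 0 := by simpa using hzs
    obtain ⟨t, h1, ht⟩ := ((hD.eventually_mem hz hy).and self_mem_nhdsWithin).exists
    have h3 : z + t • y ∈ span ℝ (_root_.signPart g 0 D) := subset_span ⟨h1, by simp [hgy, hgz]⟩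
    have h4 : t • y ∈ span ℝ (_root_.signPart g 0 D) := by
      simpa using sub_mem h3 (subset_span ⟨hz, hzs⟩)
    exact (smul_mem_iff _ (ne_of_gt ht)).1 h4

lemma IsRelOpenCone.coneEuler_signPart_of_ne_zero (hD : IsRelOpenCone D) {s : SignType}
    (hs : s ≠ 0) (hne : (_root_.signPart g s D).Nonempty) :
    coneEuler (_root_.signPart g s D) = coneEuler D := by
  rw [coneEuler, coneEuler, if_pos hne, if_pos (hne.mono (signPart_subset g s D)),
    hD.span_signPart_of_ne_zero hs hne]

lemma eulerSum_sum (L : List (Dual ℝ X)) (D : Set X) {ι : Type*} (s : Finset ι)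
    (φ : ι → X → ℤ) :
    eulerSum L D (fun v => ∑ i ∈ s, φ i v) = ∑ i ∈ s, eulerSum L D (φ i) := by
  induction L generalizing D with
  | nil =>
    simp only [eulerSum]
    split_ifs
    · rw [Finset.sum_mul]
    · simp
  | cons g L ih =>
    simp only [eulerSum, ih]
    exact Finset.sum_comm

lemma eulerSum_perm {L M : List (Dual ℝ X)} (h : L.Perm M) (D : Set X) (φ : X → ℤ) :
    eulerSum L D φ = eulerSum M D φ := by
  induction h generalizing D with
  | nil => rfl
  | cons g _ ih => simp only [eulerSum, ih]
  | swap g h L =>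
    simp only [eulerSum]
    rw [Finset.sum_comm]
    simp only [signPart_comm]
  | trans _ _ ih₁ ih₂ => rw [ih₁, ih₂]

/-- If every cell of the arrangement `L` contributes zero, so does the whole set. -/
lemma IsRelOpenCone.eulerSum_append_eq_zero (hD : IsRelOpenCone D) (L M : List (Dual ℝ X))
    {φ : X → ℤ} {w : X} (hL : ∀ f ∈ L, f w = 0) (hw : ∀ v ∈ D, ∀ t : ℝ, v + t • w ∈ D)
    (h : ∀ D' ⊆ D, IsRelOpenCone D' → (∀ v ∈ D', ∀ t : ℝ, v + t • w ∈ D') →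
      (∀ f ∈ L, ∀ u ∈ D', ∀ v ∈ D', SignType.sign (f u) = SignType.sign (f v)) →
      eulerSum M D' φ = 0) :
    eulerSum (L ++ M) D φ = 0 := by
  induction L generalizing D with
  | nil => exact h D subset_rfl hD hw (by simp)
  | cons g L ih =>
    simp only [eulerSum, List.cons_append]
    refine Finset.sum_eq_zero fun s _ => ih (hD.signPart g s) (fun f hf => hL f (by simp [hf]))
      ?_ ?_
    · rintro v ⟨hv, hvs⟩ t
      refine ⟨hw v hv t, ?_⟩
      simpa [hL g (by simp)] using hvs
    · intro D' hD' hO hw' hc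
      refine h D' (hD'.trans (signPart_subset g s D)) hO hw' fun f hf u hu v hv => ?_
      rcases List.mem_cons.1 hf with rfl | hf
      · exact (hD' hu).2.trans (hD' hv).2.symm
      · exact hc f hf u hu v hv

lemma sum_signType (f : SignType → ℤ) : ∑ s, f s = f (-1) + f 0 + f 1 := by
  have : (Finset.univ : Finset SignType) = {-1, 0, 1} := by decide
  rw [this]
  simp [add_assoc]

variable [FiniteDimensional ℝ X]

lemma IsRelOpenCone.coneEuler_signPart_zero (hD : IsRelOpenCone D)
    (hne : (_root_.signPart g 0 D).Nonempty) {y : X} (hy : y ∈ D) (hgy : g y ≠ 0) :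
    coneEuler (_root_.signPart g 0 D) = -coneEuler D := by
  rw [coneEuler, coneEuler, if_pos hne, if_pos (hne.mono (signPart_subset g 0 D)),
    hD.span_signPart_zero hne]
  have hk : finrank ℝ ↥(span ℝ D ⊓ LinearMap.ker g) + 1 = finrank ℝ (span ℝ D) := by
    have h1 := LinearMap.finrank_range_add_finrank_ker (g.domRestrict (span ℝ D))
    have hsurj : LinearMap.range (g.domRestrict (span ℝ D)) = ⊤ := by
      refine LinearMap.range_eq_top.2 (LinearMap.surjective fun h => hgy ?_)
      exact LinearMap.congr_fun h ⟨y, subset_span hy⟩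
    have h2 : LinearMap.ker (g.domRestrict (span ℝ D)) =
        (span ℝ D ⊓ LinearMap.ker g).comap (span ℝ D).subtype := by
      ext v; simp
    rw [hsurj, finrank_top, finrank_self, h2,
      (comapSubtypeEquivOfLe (inf_le_left : span ℝ D ⊓ LinearMap.ker g ≤ _)).finrank_eq] at h1
    omega
  rw [← hk, pow_succ]
  ring

/-- Cutting a relatively open cone by a hyperplane preserves the Euler characteristic. -/
lemma IsRelOpenCone.sum_coneEuler_signPart (hD : IsRelOpenCone D) (g : Dual ℝ X) :
    ∑ s, coneEuler (_root_.signPart g s D) = coneEuler D := by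
  by_cases hconst : ∃ s, ∀ v ∈ D, SignType.sign (g v) = s
  · obtain ⟨s, hs⟩ := hconst
    rw [Finset.sum_eq_single s]
    · congr 1
      exact Set.inter_eq_left.2 hs
    · intro t _ hts
      rw [coneEuler, if_neg]
      rintro ⟨v, hv, hvt⟩
      exact hts (hvt.symm.trans (hs v hv))
    · simp
  · push Not at hconst
    have hzero : ∃ z ∈ D, g z = 0 := by
      by_contra! hz
      obtain ⟨u, hu, hu1⟩ := hconst 1
      obtain ⟨v, hv, hv1⟩ := hconst (-1)
      have hu2 : g u < 0 := lt_of_le_of_ne (by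
        by_contra! h; exact hu1 (sign_pos h)) (hz u hu)
      have hv2 : 0 < g v := lt_of_le_of_ne (by
        by_contra! h; exact hv1 (sign_neg h)) (hz v hv).symm
      refine hz (g v • u + (-g u) • v)
        (hD.add_mem (hD.smul_mem hv2 hu) (hD.smul_mem (by linarith) hv)) ?_
      simp; ring
    obtain ⟨z, hz, hgz⟩ := hzero
    obtain ⟨y, hy, hgy⟩ := hconst 0
    have hgy : g y ≠ 0 := fun h => hgy (by rw [h, sign_zero])
    have hall : ∀ s : SignType, s ≠ 0 → (_root_.signPart g s D).Nonempty := by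
      intro s hs
      have key : ∀ c : ℝ, ∃ t > (0 : ℝ), z + t • (c • y) ∈ D := fun c => by
        obtain ⟨t, h1, ht⟩ := ((hD.eventually_mem hz (Submodule.smul_mem _ c (subset_span hy))).and
          self_mem_nhdsWithin).exists
        exact ⟨t, ht, h1⟩
      have hsq : 0 < g y * g y := mul_self_pos.2 hgy
      have hpos : ∀ t : ℝ, 0 < t → 0 < t * (g y * g y) := fun t ht => mul_pos ht hsq
      cases s
      · exact absurd rfl hs
      · obtain ⟨t, ht, h⟩ := key (-g y)
        refine ⟨_, h, ?_⟩
        simpa [hgz] using sign_neg (neg_lt_zero.2 (hpos t ht))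
      · obtain ⟨t, ht, h⟩ := key (g y)
        refine ⟨_, h, ?_⟩
        simpa [hgz] using sign_pos (hpos t ht)
    rw [sum_signType, hD.coneEuler_signPart_of_ne_zero (s := -1) (by decide) (hall _ (by decide)),
      hD.coneEuler_signPart_of_ne_zero (s := 1) (by decide) (hall _ (by decide)),
      hD.coneEuler_signPart_zero ⟨z, hz, by simp [hgz]⟩ hy hgy]
    ring

lemma IsRelOpenCone.eulerSum_of_const (hD : IsRelOpenCone D) (L : List (Dual ℝ X)) {φ : X → ℤ}
    {c : ℤ} (hφ : ∀ v ∈ D, φ v = c) : eulerSum L D φ = c * coneEuler D := by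
  induction L generalizing D with
  | nil =>
    simp only [eulerSum]
    split_ifs with h
    · rw [hφ _ h.some_mem]
    · simp [coneEuler, h]
  | cons g L ih =>
    simp only [eulerSum]
    rw [← hD.sum_coneEuler_signPart g, Finset.mul_sum]
    exact Finset.sum_congr rfl fun s _ =>
      ih (hD.signPart g s) fun v hv => hφ v (signPart_subset g s D hv)

/-- Refining the arrangement does not change the integral of a function that is constant on the
cells. -/
lemma IsRelOpenCone.eulerSum_append (hD : IsRelOpenCone D) (L M : List (Dual ℝ X)) {φ : X → ℤ}
    (hφ : ∀ u ∈ D, ∀ v ∈ D, (∀ f ∈ L, SignType.sign (f u) = SignType.sign (f v)) → φ u = φ v) :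
    eulerSum (L ++ M) D φ = eulerSum L D φ := by
  induction L generalizing D with
  | nil =>
    by_cases h : D.Nonempty
    · simp only [eulerSum, List.nil_append, dif_pos h]
      exact hD.eulerSum_of_const M fun v hv => hφ v hv _ h.some_mem (by simp)
    · simp only [eulerSum, List.nil_append, dif_neg h]
      rw [hD.eulerSum_of_const M (c := 0) fun v hv => absurd ⟨v, hv⟩ h, zero_mul]
  | cons g L ih =>
    simp only [eulerSum, List.cons_append]
    refine Finset.sum_congr rfl fun s _ => ih (hD.signPart g s) fun u hu v hv huv => ?_
    refine hφ u hu.1 v hv.1 fun f hf => ?_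
    rcases List.mem_cons.1 hf with rfl | hf
    · exact hu.2.trans hv.2.symm
    · exact huv f hf

/-- The indicator function of a single cell integrates to the Euler characteristic of the cell. -/
lemma IsRelOpenCone.eulerSum_cell (hD : IsRelOpenCone D) (L : List (Dual ℝ X))
    (σ : Dual ℝ X → SignType) (P : Set X)
    (hP : ∀ v ∈ D, v ∈ P ↔ ∀ f ∈ L, SignType.sign (f v) = σ f) :
    eulerSum L D (fun v => if v ∈ P then 1 else 0) = coneEuler (D ∩ P) := by
  induction L generalizing D with
  | nil =>
    have hDP : D ∩ P = D := Set.inter_eq_left.2 fun v hv => (hP v hv).2 (by simp)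
    rw [hDP, hD.eulerSum_of_const [] (c := 1), one_mul]
    intro v hv
    rw [if_pos ((hP v hv).2 (by simp))]
  | cons g L ih =>
    simp only [eulerSum]
    rw [Finset.sum_eq_single (σ g)]
    · rw [ih (hD.signPart g _)]
      · congr 1
        ext v
        refine ⟨fun h => ⟨h.1.1, h.2⟩, fun h => ⟨⟨h.1, ?_⟩, h.2⟩⟩
        exact (hP v h.1).1 h.2 g (by simp)
      · rintro v ⟨hv, hvg⟩
        have hvg : SignType.sign (g v) = σ g := hvg
        rw [hP v hv, List.forall_mem_cons]
        simp [hvg]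
    · intro s _ hs
      rw [(hD.signPart g s).eulerSum_of_const L (c := 0), zero_mul]
      rintro v ⟨hv, hvg⟩
      rw [if_neg]
      intro h
      exact hs (hvg.symm.trans ((hP v hv).1 h g (by simp)))
    · simp

/-- The Euler characteristic of a polyhedral cone that is not a linear subspace vanishes. -/
lemma eulerSum_polyhedralCone (L : List (Dual ℝ X)) {w : X} (hw : ∀ f ∈ L, f w ≤ 0)
    (hw' : ∃ f ∈ L, f w ≠ 0) :
    eulerSum L Set.univ (fun v => if ∀ f ∈ L, f v ≤ 0 then 1 else 0) = 0 := by
  set φ : X → ℤ := fun v => if ∀ f ∈ L, f v ≤ 0 then 1 else 0 with hφ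
  set Δ : List (Dual ℝ X) := L.flatMap fun f => L.map fun g => g w • f - f w • g with hΔ
  have memΔ : ∀ f ∈ L, ∀ g ∈ L, g w • f - f w • g ∈ Δ := fun f hf g hg =>
    List.mem_flatMap.2 ⟨f, hf, List.mem_map.2 ⟨g, hg, rfl⟩⟩
  rw [← isRelOpenCone_univ.eulerSum_append L Δ, eulerSum_perm List.perm_append_comm]
  swap
  · intro u _ v _ huv
    simp only [hφ]
    congr 1
    refine propext (forall₂_congr fun f hf => ?_)
    rw [← sign_nonpos_iff, huv f hf, sign_nonpos_iff]
  refine isRelOpenCone_univ.eulerSum_append_eq_zero (w := w) Δ L ?_ (fun _ _ _ => trivial) ?_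
  · intro δ hδ
    obtain ⟨f, -, hδ⟩ := List.mem_flatMap.1 hδ
    obtain ⟨g, -, rfl⟩ := List.mem_map.1 hδ
    simp [mul_comm]
  intro D _ hD hDw hconst
  rcases D.eq_empty_or_nonempty with rfl | ⟨v₀, hv₀⟩
  · rw [hD.eulerSum_of_const L (c := 0) (by simp), zero_mul]
  obtain ⟨f₁, hf₁, hf₁w⟩ : ∃ f ∈ L, f w < 0 := by
    obtain ⟨f, hf, h⟩ := hw'
    exact ⟨f, hf, lt_of_le_of_ne (hw f hf) h⟩
  obtain ⟨i, hi, himax⟩ := (L.toFinset.filter fun f => f w < 0).exists_max_image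
    (fun f => f v₀ / (-f w)) ⟨f₁, by simp [hf₁, hf₁w]⟩
  simp only [Finset.mem_filter, List.mem_toFinset, and_imp] at hi himax
  obtain ⟨hi, hiw⟩ := hi
  have hdom : ∀ f ∈ L, f w < 0 → ∀ v ∈ D, i v ≤ 0 → f v ≤ 0 := by
    intro f hf hfw v hv hiv
    have h1 := himax f hf hfw
    rw [div_le_div_iff₀ (by linarith) (by linarith)] at h1
    have h2 : 0 ≤ SignType.sign ((i w • f - f w • i) v₀) := by
      rw [sign_nonneg_iff]; simp; linarith
    rw [hconst _ (memΔ f hf i hi) v₀ hv₀ v hv, sign_nonneg_iff] at h2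
    simp only [LinearMap.sub_apply, LinearMap.smul_apply, smul_eq_mul] at h2
    by_contra! hfv
    nlinarith [mul_pos hfv (neg_pos.2 hiw), mul_nonneg (neg_nonneg.2 hfw.le) (neg_nonneg.2 hiv)]
  by_cases hpos : ∃ f ∈ L, f w = 0 ∧ 0 < f v₀
  · obtain ⟨f, hf, hfw, hfv⟩ := hpos
    rw [hD.eulerSum_of_const L (c := 0), zero_mul]
    intro v hv
    simp only [hφ]
    rw [if_neg]
    intro hall
    have h1 := hconst _ (memΔ f hf i hi) v₀ hv₀ v hv
    have h2 : SignType.sign ((i w • f - f w • i) v₀) = -1 := by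
      apply sign_neg
      simp [hfw]
      exact mul_neg_of_neg_of_pos hiw hfv
    rw [h2, eq_comm, sign_eq_neg_one_iff] at h1
    simp [hfw] at h1
    nlinarith [hall f hf]
  push Not at hpos
  have hφi : ∀ v ∈ D, φ v = if i v ≤ 0 then 1 else 0 := by
    intro v hv
    simp only [hφ]
    congr 1
    refine propext ⟨fun h => h i hi, fun h f hf => ?_⟩
    rcases (hw f hf).lt_or_eq with hfw | hfw
    · exact hdom f hf hfw v hv h
    · have h1 := hconst _ (memΔ f hf i hi) v₀ hv₀ v hv
      have h2 : 0 ≤ SignType.sign ((i w • f - f w • i) v₀) := by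
        rw [sign_nonneg_iff]
        simp [hfw]
        exact mul_nonneg_of_nonpos_of_nonpos hiw.le (hpos f hf hfw)
      rw [h1, sign_nonneg_iff] at h2
      simp [hfw] at h2
      by_contra! hfv
      nlinarith
  rw [eulerSum_perm (List.perm_cons_erase hi)]
  simp only [eulerSum]
  have hshift : ∀ c : ℝ, ∃ v ∈ D, i v = c := fun c =>
    ⟨v₀ + ((c - i v₀) / i w) • w, hDw v₀ hv₀ _, by
      simp; field_simp [hiw.ne]; ring⟩
  rw [sum_signType, (hD.signPart i (-1)).eulerSum_of_const _ (c := 1),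
    (hD.signPart i 0).eulerSum_of_const _ (c := 1), (hD.signPart i 1).eulerSum_of_const _ (c := 0)]
  · obtain ⟨u, hu, hu1⟩ := hshift (-1)
    obtain ⟨z, hz, hz0⟩ := hshift 0
    rw [hD.coneEuler_signPart_of_ne_zero (s := -1) (by decide) ⟨u, hu, by simp [hu1]⟩,
      hD.coneEuler_signPart_zero ⟨z, hz, by simp [hz0]⟩ hu (by simp [hu1])]
    ring
  · rintro v ⟨hv, hvs⟩
    have : 0 < i v := by simpa [sign_eq_one_iff] using hvs
    rw [hφi v hv, if_neg this.not_ge]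
  · rintro v ⟨hv, hvs⟩
    have : i v = 0 := by simpa using hvs
    rw [hφi v hv, if_pos this.le]
  · rintro v ⟨hv, hvs⟩
    have : i v < 0 := by simpa [sign_eq_neg_one_iff] using hvs
    rw [hφi v hv, if_pos this.le]

end OpenCones

section Faces

open Topology Filter Module Submodule

variable {E : Type*} [AddCommGroup E] [Module ℝ E]

lemma LinearMap.le_of_mem_convexHull {s : Set E} {f : E →ₗ[ℝ] ℝ} {c : ℝ}
    (hf : ∀ v ∈ s, f v ≤ c) {y : E} (hy : y ∈ convexHull ℝ s) : f y ≤ c :=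
  convexHull_min (t := {y | f y ≤ c}) hf (convex_halfSpace_le f.isLinear c) hy

/-- A face of a polytope is the convex hull of the given points which it contains. -/
lemma face_eq_convexHull {V : Finset E} {f : E →ₗ[ℝ] ℝ} {c : ℝ} (hf : ∀ v ∈ V, f v ≤ c) :
    {y ∈ convexHull ℝ (V : Set E) | f y = c} = convexHull ℝ {v ∈ (V : Set E) | f v = c} := by
  apply subset_antisymm
  · rintro y ⟨hy, hfy⟩
    obtain ⟨w, hw0, hw1, rfl⟩ := Finset.mem_convexHull'.1 hy
    have h0 : ∑ v ∈ V, w v * (c - f v) = 0 := by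
      simp only [mul_sub, Finset.sum_sub_distrib, ← Finset.sum_mul, hw1, ← hfy, map_sum, map_smul,
        smul_eq_mul]
      ring
    rw [Finset.sum_eq_zero_iff_of_nonneg
      (fun v hv => mul_nonneg (hw0 v hv) (sub_nonneg.2 (hf v hv)))] at h0
    have hz : ∀ v ∈ V, w v ≠ 0 → f v = c := fun v hv hne => by
      have := (mul_eq_zero.1 (h0 v hv)).resolve_left hne
      linarith
    rw [← Finset.sum_filter_of_ne (p := fun v => f v = c)
      (fun v hv hne => hz v hv fun h => hne (by rw [h, zero_smul]))]
    rw [← Finset.sum_filter_of_ne (p := fun v => f v = c) hz] at hw1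
    refine (convex_convexHull ℝ _).sum_mem (fun v hv => hw0 v (Finset.mem_filter.1 hv).1) hw1
      fun v hv => subset_convexHull ℝ _ ?_
    simpa using hv
  · refine convexHull_min ?_ ((convex_convexHull ℝ _).inter (convex_hyperplane f.isLinear c))
    rintro v ⟨hv, hfv⟩
    exact ⟨subset_convexHull ℝ _ hv, hfv⟩

/-- The functionals that attain their maximum over `P` at `x` and at exactly the points of `F`. -/
def normalCell (P : Set E) (x : E) (F : Set E) : Set (Dual ℝ E) :=
  {f | (∀ y ∈ P, f y ≤ f x) ∧ F = {y ∈ P | f y = f x}}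

lemma mem_normalCell_iff {V : Finset E} {x : E} {F : Set E} {f₀ : Dual ℝ E}
    (h₀ : f₀ ∈ normalCell (convexHull ℝ (V : Set E)) x F) (f : Dual ℝ E) :
    f ∈ normalCell (convexHull ℝ (V : Set E)) x F ↔
      ∀ v ∈ V, SignType.sign (f (v - x)) = SignType.sign (f₀ (v - x)) := by
  have hV : ∀ {v}, v ∈ V → v ∈ convexHull ℝ (V : Set E) := fun hv => subset_convexHull ℝ _ hv
  obtain ⟨h₀, hF₀⟩ := h₀
  constructor
  · rintro ⟨h, hF⟩ v hv
    have key : ∀ g : Dual ℝ E, (∀ y ∈ convexHull ℝ (V : Set E), g y ≤ g x) →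
        F = {y ∈ convexHull ℝ (V : Set E) | g y = g x} →
        SignType.sign (g (v - x)) = if v ∈ F then 0 else -1 := by
      intro g hg hgF
      have hvF : v ∈ F ↔ g v = g x := by
        rw [hgF]; exact ⟨fun h => h.2, fun h => ⟨hV hv, h⟩⟩
      split_ifs with hmem
      · simp [hvF.1 hmem]
      · rw [sign_eq_neg_one_iff, map_sub, sub_neg]
        exact lt_of_le_of_ne (hg v (hV hv)) fun h => hmem (hvF.2 h)
    rw [key f h hF, key f₀ h₀ hF₀]
  · intro h
    have hle : ∀ v ∈ V, f v ≤ f x := fun v hv => by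
      have h1 : SignType.sign (f₀ (v - x)) ≤ 0 := by
        rw [sign_nonpos_iff, map_sub, sub_nonpos]
        exact h₀ v (hV hv)
      rw [← h v hv, sign_nonpos_iff, map_sub, sub_nonpos] at h1
      exact h1
    refine ⟨fun y hy => LinearMap.le_of_mem_convexHull hle hy, ?_⟩
    rw [hF₀, face_eq_convexHull hle, face_eq_convexHull fun v hv => h₀ v (hV hv)]
    congr 1
    ext v
    refine and_congr_right fun hv => ?_
    rw [← sub_eq_zero, ← map_sub, ← sign_eq_zero_iff, ← h v hv, sign_eq_zero_iff, map_sub,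
      sub_eq_zero]

lemma span_normalCell {V : Finset E} {x : E} {F : Set E} (hx : x ∈ F)
    (hne : (normalCell (convexHull ℝ (V : Set E)) x F).Nonempty) :
    span ℝ (normalCell (convexHull ℝ (V : Set E)) x F) =
      (affineSpan ℝ F).direction.dualAnnihilator := by
  rw [direction_affineSpan, vectorSpan_eq_span_vsub_set_right ℝ hx]
  apply le_antisymm
  · rw [span_le]
    rintro f ⟨-, hF⟩
    rw [SetLike.mem_coe, mem_dualAnnihilator]
    have : span ℝ ((fun y => y -ᵥ x) '' F) ≤ LinearMap.ker f := by
      rw [span_le]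
      rintro _ ⟨y, hy, rfl⟩
      rw [hF] at hy
      simpa [sub_eq_zero] using hy.2
    exact fun y hy => this hy
  · intro g hg
    rw [mem_dualAnnihilator] at hg
    obtain ⟨f₀, h₀⟩ := hne
    have hev : ∀ᶠ t in 𝓝[>] (0 : ℝ),
        f₀ + t • g ∈ normalCell (convexHull ℝ (V : Set E)) x F := by
      simp only [mem_normalCell_iff h₀, eventually_all_finset]
      intro v hv
      refine eventually_sign_add_mul fun h => hg _ (subset_span ⟨v, ?_, rfl⟩)
      rw [h₀.2]
      exact ⟨subset_convexHull ℝ _ hv, by simpa [sub_eq_zero] using h⟩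
    obtain ⟨t, h1, ht⟩ := (hev.and self_mem_nhdsWithin).exists
    have h2 : t • g ∈ span ℝ (normalCell (convexHull ℝ (V : Set E)) x F) := by
      simpa using sub_mem (subset_span h1) (subset_span h₀)
    exact (smul_mem_iff _ (ne_of_gt ht)).1 h2

lemma finite_setOf_normalCell_nonempty (V : Finset E) (x : E) :
    {F | (normalCell (convexHull ℝ (V : Set E)) x F).Nonempty}.Finite := by
  refine (V.powerset.finite_toSet.image fun s : Finset E => convexHull ℝ (s : Set E)).subset ?_
  rintro F ⟨f, hf, rfl⟩
  refine ⟨V.filter fun v => f v = f x,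
    Finset.mem_coe.2 (Finset.mem_powerset.2 (Finset.filter_subset _ _)), ?_⟩
  rw [face_eq_convexHull fun v hv => hf v (subset_convexHull ℝ _ hv)]
  simp

/-- Euler's relation for the faces of a polytope through a point `x` at which some functional
`w` is maximal without being constant on the polytope. -/
lemma sum_faces_eq_zero [FiniteDimensional ℝ E] {V : Finset E} {x : E}
    (hx : x ∈ convexHull ℝ (V : Set E)) {w : Dual ℝ E} (hw : ∀ v ∈ V, w v ≤ w x)
    (hw' : ∃ v ∈ V, w v ≠ w x) {S : Finset (Set E)}
    (hS : ∀ F, F ∈ S ↔ (normalCell (convexHull ℝ (V : Set E)) x F).Nonempty) :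
    ∑ F ∈ S, (-1 : ℤ) ^ (finrank ℝ E - finrank ℝ (affineSpan ℝ F).direction) = 0 := by
  set P := convexHull ℝ (V : Set E)
  set L : List (Dual ℝ (Dual ℝ E)) := V.toList.map fun v => Dual.eval ℝ E (v - x) with hL
  have hLV : ∀ p : Dual ℝ (Dual ℝ E) → Prop,
      (∀ ℓ ∈ L, p ℓ) ↔ ∀ v ∈ V, p (Dual.eval ℝ E (v - x)) := by simp [hL]
  have key : eulerSum L Set.univ (fun f => if ∀ ℓ ∈ L, ℓ f ≤ 0 then 1 else 0) = 0 := by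
    refine eulerSum_polyhedralCone L (w := w) ((hLV _).2 fun v hv => ?_) ?_
    · simpa using hw v hv
    · obtain ⟨v, hv, hne⟩ := hw'
      exact ⟨_, List.mem_map.2 ⟨v, by simpa using hv, rfl⟩, by simpa [sub_eq_zero] using hne⟩
  have hsum : (fun f : Dual ℝ E => if ∀ ℓ ∈ L, ℓ f ≤ 0 then (1 : ℤ) else 0) =
      fun f => ∑ F ∈ S, if f ∈ normalCell P x F then 1 else 0 := by
    funext f
    split_ifs with hf
    · rw [hLV] at hf
      have hf : ∀ y ∈ P, f y ≤ f x := fun y hy =>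
        LinearMap.le_of_mem_convexHull (fun v hv => by simpa using hf v hv) hy
      have hmem : f ∈ normalCell P x {y ∈ P | f y = f x} := ⟨hf, rfl⟩
      rw [Finset.sum_eq_single {y ∈ P | f y = f x}, if_pos hmem]
      · intro F _ hne
        rw [if_neg fun h => hne h.2]
      · exact fun h => absurd ((hS _).2 ⟨f, hmem⟩) h
    · refine (Finset.sum_eq_zero fun F _ => if_neg fun h => hf ?_).symm
      rw [hLV]
      intro v hv
      simpa using h.1 v (subset_convexHull ℝ _ hv)
  rw [hsum, eulerSum_sum] at key
  rw [← key]
  refine Finset.sum_congr rfl fun F hF => ?_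
  have hne := (hS F).1 hF
  obtain ⟨f₀, h₀⟩ := hne
  rw [isRelOpenCone_univ.eulerSum_cell L (fun ℓ => SignType.sign (ℓ f₀)), Set.univ_inter,
    coneEuler, if_pos ⟨f₀, h₀⟩, span_normalCell (by rw [h₀.2]; exact ⟨hx, rfl⟩) ⟨f₀, h₀⟩]
  · congr 1
    have := Subspace.finrank_add_finrank_dualAnnihilator_eq (affineSpan ℝ F).direction
    omega
  · intro f _
    rw [mem_normalCell_iff h₀, hLV]
    rfl

end Faces

/-- **Inclusion–exclusion for the interior of a polytope.** For a polytope `T ⊆ ℝ^m` with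
non-empty interior, pointwise
`𝟙_{int T} = Σ_{k=0}^m (−1)^k Σ_{F ∈ 𝓕_{m−k}(T)} 𝟙_F`, where `𝓕_j(T)` is the set of
`j`-dimensional faces of `T`. The inner sum of indicators evaluated at `x` is the number of
`(m−k)`-dimensional faces of `T` containing `x`. -/
theorem indicator_interior_polytope (m : ℕ) (T : Set (EuclideanSpace ℝ (Fin m)))
    (hT : ∃ V : Finset (EuclideanSpace ℝ (Fin m)), T = convexHull ℝ ↑V)
    (hTint : (interior T).Nonempty) (x : EuclideanSpace ℝ (Fin m)) :
    (if x ∈ interior T then (1 : ℤ) else 0)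
      = ∑ k ∈ Finset.range (m + 1), (-1 : ℤ) ^ k *
          ({F : Set (EuclideanSpace ℝ (Fin m)) |
              IsFace T F ∧ adim F = m - k ∧ x ∈ F}.ncard : ℤ) := by
  obtain ⟨V, rfl⟩ := hT
  set P := convexHull ℝ (V : Set (EuclideanSpace ℝ (Fin m))) with hP
  have hspan : affineSpan ℝ P = ⊤ := affineSpan_eq_top_of_nonempty_interior (by
    rwa [hP, (convex_convexHull ℝ _).convexHull_eq])
  by_cases hx : x ∈ P
  swap
  · rw [if_neg fun h => hx (interior_subset h)]
    refine (Finset.sum_eq_zero fun k _ => ?_).symm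
    have : {F | IsFace P F ∧ adim F = m - k ∧ x ∈ F} = ∅ := by
      refine Set.eq_empty_of_forall_notMem ?_
      rintro F ⟨hF, -, hxF⟩
      rcases hF with rfl | ⟨-, f, c, -, -, rfl⟩
      · exact hx hxF
      · exact hx hxF.1
    rw [this]
    simp
  have hface : ∀ F, (IsFace P F ∧ x ∈ F) ↔ (normalCell P x F).Nonempty := by
    intro F
    constructor
    · rintro ⟨rfl | ⟨-, f, c, -, hf, rfl⟩, hxF⟩
      · exact ⟨0, by simp, by simp⟩
      · refine ⟨f, ?_, ?_⟩ <;> rw [hxF.2]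
        exact hf
    · rintro ⟨f, hf, rfl⟩
      refine ⟨?_, hx, rfl⟩
      by_cases h0 : f = 0
      · left; simp [h0]
      · exact Or.inr ⟨⟨x, hx, rfl⟩, f, f x, h0, hf, rfl⟩
  set S := (finite_setOf_normalCell_nonempty V x).toFinset with hSdef
  have hS : ∀ F, F ∈ S ↔ (normalCell P x F).Nonempty := fun F => by simp [hSdef, hP]
  have hdim : ∀ F : Set (EuclideanSpace ℝ (Fin m)), adim F ≤ m := fun F => by
    simpa [adim] using Submodule.finrank_le (affineSpan ℝ F).direction
  have hsum : ∑ k ∈ Finset.range (m + 1), (-1 : ℤ) ^ k *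
      ({F : Set (EuclideanSpace ℝ (Fin m)) | IsFace P F ∧ adim F = m - k ∧ x ∈ F}.ncard : ℤ)
      = ∑ F ∈ S, (-1 : ℤ) ^ (m - adim F) := by
    rw [← Finset.sum_fiberwise_of_maps_to (t := Finset.range (m + 1)) (g := fun F => m - adim F)
      (fun F _ => Finset.mem_range.2 (by omega))]
    refine Finset.sum_congr rfl fun k hk => ?_
    have hset : {F | IsFace P F ∧ adim F = m - k ∧ x ∈ F} =
        (S.filter fun F => m - adim F = k : Finset (Set (EuclideanSpace ℝ (Fin m)))) := by
      ext F
      have h1 := hdim F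
      have h2 := Finset.mem_range.1 hk
      have h3 : adim F = m - k ↔ m - adim F = k := by omega
      simp only [Set.mem_ofPred_eq, Finset.coe_filter, hS, ← hface, h3]
      tauto
    rw [hset, Set.ncard_coe_finset, Finset.sum_congr rfl fun F hF => by
      rw [(Finset.mem_filter.1 hF).2], Finset.sum_const, nsmul_eq_mul, mul_comm]
  rw [hsum]
  split_ifs with hint
  · have hSP : S = {P} := by
      ext F
      rw [hS, Finset.mem_singleton]
      constructor
      · rintro ⟨f, hf, rfl⟩
        have hmax : IsLocalMax f x := by
          filter_upwards [mem_interior_iff_mem_nhds.1 hint] with y hy using hf y hy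
        have h0 : f = 0 := by
          have h1 := hmax.hasFDerivAt_eq_zero (f' := LinearMap.toContinuousLinearMap f)
            (LinearMap.toContinuousLinearMap f).hasFDerivAt
          exact LinearMap.ext fun y => congrArg (fun φ => φ y) h1
        simp [h0]
      · rintro rfl
        exact ⟨0, by simp, by simp⟩
    rw [hSP, Finset.sum_singleton, adim, hspan, AffineSubspace.direction_top]
    simp
  · obtain ⟨w, hw⟩ := geometric_hahn_banach_open_point (convex_convexHull ℝ _).interior
      isOpen_interior hint
    obtain ⟨z, hz⟩ := hTint
    have hle : ∀ y ∈ P, w y ≤ w x := by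
      intro y hy
      have hcl : y ∈ closure (interior P) := by
        rw [(convex_convexHull ℝ _).closure_interior_eq_closure_of_nonempty_interior ⟨z, hz⟩]
        exact subset_closure hy
      exact closure_minimal (t := {y | w y ≤ w x}) (fun y hy => (hw y hy).le)
        (isClosed_le w.continuous continuous_const) hcl
    have h := sum_faces_eq_zero (V := V) hx (w := w.toLinearMap)
      (fun v hv => hle v (subset_convexHull ℝ _ hv)) ?_ hS
    · simpa [adim] using h.symm
    · by_contra! hconst
      have hge : P ⊆ {y | w y = w x} :=
        convexHull_min hconst (convex_hyperplane w.toLinearMap.isLinear _)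
      exact (hw z hz).ne (hge (interior_subset hz))
end
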